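/- Let C be a d-arrangement of k ≥ 4 curves in ℂP² with t_2 ≠ 0 and t_r = 0 for all r > 2, and G its Levi graph. Then reg(S/J_G^t) ≥ 2t + 2k − 4 for all t ≥ 1. -/

import Mathlib

open MvPolynomial

set_option linter.unusedSectionVars false

/-- The Levi graph of an arrangement of curves `C : ι → Set P` with singular points `S`:
the bipartite incidence graph between singular points and curves. -/
def leviGraph {P ι : Type*} (C : ι → Set P) (S : Finset P) :
    SimpleGraph ({p // p ∈ S} ⊕ ι) :=
  SimpleGraph.fromRel (fun u v => ∃ (p : {p // p ∈ S}) (i : ι),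
    u = Sum.inl p ∧ v = Sum.inr i ∧ (p : P) ∈ C i)

/-- The binomial edge ideal of a simple graph `G`, in the polynomial ring with two
variables `x_v = X (Sum.inl v)` and `y_v = X (Sum.inr v)` for each vertex `v`. -/
noncomputable def binomialEdgeIdeal {V : Type*} (K : Type*) [Field K] (G : SimpleGraph V) :
    Ideal (MvPolynomial (V ⊕ V) K) :=
  Ideal.span {f | ∃ u v : V, G.Adj u v ∧
    f = X (Sum.inl u) * X (Sum.inr v) - X (Sum.inl v) * X (Sum.inr u)}

/-- A finite graded free resolution of `S ⧸ J`: homological data recorded by ranks `rk i`,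
twists `tw i` (the `r`-th summand of the `i`-th term is `S(- tw i r)`), matrices `mat i`
of the differentials `F (i+1) → F i` and the augmentation `F 0 → S ⧸ J`, with homogeneous
entries of the appropriate degrees, which is exact. -/
structure GradedFreeResolution {σ K : Type*} [Field K] (J : Ideal (MvPolynomial σ K)) :
    Type _ where
  len : ℕ
  rk : ℕ → ℕ
  tw : (i : ℕ) → Fin (rk i) → ℕ
  mat : (i : ℕ) → Fin (rk i) → Fin (rk (i + 1)) → MvPolynomial σ K
  aug : Fin (rk 0) → MvPolynomial σ K
  finite : ∀ i : ℕ, len < i → rk i = 0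
  aug_homog : ∀ r : Fin (rk 0), (aug r).IsHomogeneous (tw 0 r)
  mat_homog : ∀ (i : ℕ) (r : Fin (rk i)) (c : Fin (rk (i + 1))),
    if tw i r ≤ tw (i + 1) c then (mat i r c).IsHomogeneous (tw (i + 1) c - tw i r)
    else mat i r c = 0
  aug_surj : ∀ s : MvPolynomial σ K, ∃ v : Fin (rk 0) → MvPolynomial σ K,
    s - ∑ r, aug r * v r ∈ J
  exact_zero : ∀ v : Fin (rk 0) → MvPolynomial σ K,
    (∑ r, aug r * v r ∈ J) ↔
      ∃ w : Fin (rk 1) → MvPolynomial σ K, ∀ r, v r = ∑ c, mat 0 r c * w c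
  exact_succ : ∀ (i : ℕ) (v : Fin (rk (i + 1)) → MvPolynomial σ K),
    (∀ r : Fin (rk i), ∑ c, mat i r c * v c = 0) ↔
      ∃ w : Fin (rk (i + 2)) → MvPolynomial σ K, ∀ c, v c = ∑ e, mat (i + 1) c e * w e

/-- The Castelnuovo–Mumford regularity of `S ⧸ J`, defined as the least `m` such that some
graded free resolution of `S ⧸ J` has all its `i`-th syzygies in degrees at most `m + i`
(the minimal free resolution realizes this minimum, which is `max { j - i : β_{i,i+j} ≠ 0 }`). -/
noncomputable def quotRegularity {σ : Type*} (K : Type*) [Field K]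
    (J : Ideal (MvPolynomial σ K)) : ℕ :=
  sInf {m : ℕ | ∃ F : GradedFreeResolution (K := K) J,
    ∀ (i : ℕ) (r : Fin (F.rk i)), F.tw i r ≤ m + i}




section Koszul

variable {σ : Type*} [LinearOrder σ] {M M' : Type*} [AddCommGroup M] [AddCommGroup M']

/-- Koszul sign. -/
def ksgn (j : σ) (A : Finset σ) : ℤ := (-1) ^ (A.filter (· < j)).card

lemma ksgn_mul_self (j : σ) (A : Finset σ) : ksgn j A * ksgn j A = 1 := by
  unfold ksgn
  rw [← mul_pow]; simp

lemma ksgn_insert (j k : σ) (A : Finset σ) (hk : k ∉ A) :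
    ksgn j (insert k A) = (if k < j then -1 else 1) * ksgn j A := by
  unfold ksgn
  rw [Finset.filter_insert]
  split_ifs with h
  · rw [Finset.card_insert_of_notMem (by simp [hk]), pow_succ]; ring
  · simp

lemma ksgn_insert_self (j : σ) (A : Finset σ) :
    ksgn j (insert j A) = ksgn j A := by
  unfold ksgn
  rw [Finset.filter_insert]
  simp

lemma ksgn_erase_self (j : σ) (A : Finset σ) :
    ksgn j (A.erase j) = ksgn j A := by
  by_cases h : j ∈ A
  · conv_rhs => rw [← Finset.insert_erase h]
    rw [ksgn_insert_self]
  · rw [Finset.erase_eq_of_notMem h]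

/-- contraction operator -/
def kio (j : σ) : (Finset σ → M) →+ (Finset σ → M) where
  toFun g A := if j ∈ A then 0 else ksgn j A • g (insert j A)
  map_zero' := by ext A; simp
  map_add' g h := by ext A; simp only [Pi.add_apply]; split_ifs <;> simp

/-- wedge operator -/
def kwe (j : σ) : (Finset σ → M) →+ (Finset σ → M) where
  toFun g A := if j ∈ A then ksgn j A • g (A.erase j) else 0
  map_zero' := by ext A; simp
  map_add' g h := by ext A; simp only [Pi.add_apply]; split_ifs <;> simp

lemma kio_apply (j : σ) (g : Finset σ → M) (A : Finset σ) :
    kio j g A = if j ∈ A then 0 else ksgn j A • g (insert j A) := rfl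

lemma kwe_apply (j : σ) (g : Finset σ → M) (A : Finset σ) :
    kwe j g A = if j ∈ A then ksgn j A • g (A.erase j) else 0 := rfl

lemma kio_map (D : M →+ M') (j : σ) (g : Finset σ → M) :
    kio j (fun A => D (g A)) = fun A => D (kio j g A) := by
  ext A; simp only [kio_apply]; split_ifs <;> simp

lemma kwe_map (D : M →+ M') (j : σ) (g : Finset σ → M) :
    kwe j (fun A => D (g A)) = fun A => D (kwe j g A) := by
  ext A; simp only [kwe_apply]; split_ifs <;> simp

lemma kio_kio_self (j : σ) (g : Finset σ → M) : kio j (kio j g) = 0 := by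
  ext A; simp [kio_apply]

lemma kio_kio (j k : σ) (g : Finset σ → M) : kio j (kio k g) = - kio k (kio j g) := by
  rcases eq_or_ne j k with rfl | hjk
  · simp [kio_kio_self]
  ext A
  simp only [kio_apply, Pi.neg_apply, Finset.mem_insert]
  by_cases hj : j ∈ A
  · simp [hj]
  by_cases hk : k ∈ A
  · simp [hk]
  simp only [hj, hk, hjk, hjk.symm, or_self, if_false]
  rw [ksgn_insert k j A hj, ksgn_insert j k A hk, smul_smul, smul_smul, Finset.insert_comm,
    ← neg_smul]
  congr 1
  rcases lt_or_gt_of_ne hjk with h | h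
  · simp [h, h.not_gt]; ring
  · simp [h, h.not_gt]; ring

lemma kio_kwe_self (j : σ) (g : Finset σ → M) :
    kio j (kwe j g) = g - kwe j (kio j g) := by
  ext A
  simp only [kio_apply, kwe_apply, Pi.sub_apply]
  by_cases hj : j ∈ A
  · simp [hj, ksgn_erase_self, smul_smul, ksgn_mul_self]
  · simp [hj, ksgn_insert_self, smul_smul, ksgn_mul_self]

lemma kio_kwe (j k : σ) (hjk : j ≠ k) (g : Finset σ → M) :
    kio j (kwe k g) = - kwe k (kio j g) := by
  ext A
  simp only [kio_apply, kwe_apply, Pi.neg_apply]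
  by_cases hj : j ∈ A
  · simp [hj, hjk]
  by_cases hk : k ∈ A
  · obtain ⟨B, hB, rfl⟩ : ∃ B, k ∉ B ∧ A = insert k B :=
      ⟨A.erase k, by simp, (Finset.insert_erase hk).symm⟩
    have hjB : j ∉ B := fun h => hj (by simp [h])
    have e1 : (insert j (insert k B)).erase k = insert j B := by
      ext x; simp only [Finset.mem_erase, Finset.mem_insert]; grind
    have e2 : (insert k B).erase k = B := by simp [hB]
    simp only [hj, if_false, Finset.mem_insert, true_or, or_true, if_true, e1, e2, hjB]
    rw [Finset.insert_comm, ksgn_insert_self, ksgn_insert_self, ksgn_insert j k B hB,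
      ksgn_insert k j B hjB, smul_smul, smul_smul, ← neg_smul]
    congr 1
    rcases lt_or_gt_of_ne hjk with h | h
    · simp [h, h.not_gt]; ring
    · simp [h, h.not_gt]; ring
  · simp [hj, hk, hjk.symm]

variable {S : Type*} [CommRing S] [Module S M] [Module S M'] [Fintype σ]

/-- Koszul differential -/
def kdf (z : σ → S) : (Finset σ → M) →+ (Finset σ → M) where
  toFun g A := ∑ j, z j • kio j g A
  map_zero' := by ext A; simp
  map_add' g h := by ext A; simp [Finset.sum_add_distrib]

lemma kdf_apply (z : σ → S) (g : Finset σ → M) (A : Finset σ) :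
    kdf z g A = ∑ j, z j • kio j g A := rfl

lemma kdf_map (z : σ → S) (D : M →ₗ[S] M') (g : Finset σ → M) :
    kdf z (fun A => D (g A)) = fun A => D (kdf z g A) := by
  ext A
  simp only [kdf_apply, map_sum, map_smul]
  refine Finset.sum_congr rfl fun j _ => ?_
  have := congrFun (kio_map D.toAddMonoidHom j g) A
  exact congrArg (z j • ·) this

lemma kio_kdf (z : σ → S) (j : σ) (g : Finset σ → M) :
    kio j (kdf z g) = - kdf z (kio j g) := by
  have : kdf z g = ∑ k, (fun A => z k • kio k g A) := by
    ext A; simp [kdf_apply]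
  rw [this, map_sum]
  ext A
  simp only [Finset.sum_apply, Pi.neg_apply, kdf_apply, ← Finset.sum_neg_distrib]
  refine Finset.sum_congr rfl fun k _ => ?_
  have := congrFun (kio_map (DistribSMul.toAddMonoidHom M (z k)) j (kio k g)) A
  simp only [DistribSMul.toAddMonoidHom_apply] at this
  rw [this, kio_kio, Pi.neg_apply, smul_neg]

lemma kdf_kdf (z : σ → S) (g : Finset σ → M) : kdf z (kdf z g) = 0 := by
  ext A
  rw [kdf_apply]
  simp only [kio_kdf, Pi.neg_apply, kdf_apply, smul_neg, Finset.sum_neg_distrib, Pi.zero_apply,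
    Finset.smul_sum, smul_smul]
  classical
  have key : ∑ j, ∑ k, (z j * z k) • kio k (kio j g) A = 0 := by
    rw [← Finset.sum_product']
    refine Finset.sum_involution (fun p _ => (p.2, p.1)) ?_ ?_ ?_ ?_
    · intro p _
      simp only
      rw [kio_kio p.1 p.2, Pi.neg_apply, smul_neg, mul_comm (z p.2) (z p.1), add_neg_cancel]
    · rintro ⟨j, k⟩ _ hne heq
      simp only [Prod.mk.injEq] at heq
      obtain ⟨rfl, _⟩ := heq
      exact hne (by simp [kio_kio_self])
    · simp
    · simp
  rw [key, neg_zero]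

lemma kdf_kwe (z : σ → S) (j : σ) (g : Finset σ → M) :
    kdf z (kwe j g) = (fun A => z j • g A) - kwe j (kdf z g) := by
  have h1 : kdf z g = ∑ k, (fun A => z k • kio k g A) := by
    ext A; simp [kdf_apply]
  have h2 : ∀ k, kwe j (fun A => z k • kio k g A) = fun A => z k • kwe j (kio k g) A := fun k =>
    kwe_map (DistribSMul.toAddMonoidHom M (z k)) j (kio k g)
  ext A
  rw [h1, map_sum, Pi.sub_apply, Finset.sum_apply, kdf_apply]
  simp only [h2]
  have : z j • g A = ∑ k, if k = j then z j • g A else 0 := by simp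
  rw [this, ← Finset.sum_sub_distrib]
  refine Finset.sum_congr rfl fun k _ => ?_
  split_ifs with hk
  · subst hk; rw [kio_kwe_self, Pi.sub_apply, smul_sub]
  · rw [kio_kwe k j hk, Pi.neg_apply, smul_neg, zero_sub]

/-- support in exterior degree p -/
def ksupp (p : ℕ) (g : Finset σ → M) : Prop := ∀ A : Finset σ, A.card ≠ p → g A = 0

lemma ksupp.sub {p : ℕ} {g h : Finset σ → M} (hg : ksupp p g) (hh : ksupp p h) :
    ksupp p (g - h) := fun A hA => by simp [hg A hA, hh A hA]

lemma ksupp_kio {p : ℕ} {g : Finset σ → M} (hg : ksupp (p+1) g) (j : σ) : ksupp p (kio j g) := by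
  intro A hA
  rw [kio_apply]
  split_ifs with h
  · rfl
  · rw [hg, smul_zero]; rw [Finset.card_insert_of_notMem h]; omega

lemma ksupp_kwe {p : ℕ} {g : Finset σ → M} (hg : ksupp p g) (j : σ) : ksupp (p+1) (kwe j g) := by
  intro A hA
  rw [kwe_apply]
  split_ifs with h
  · rw [hg, smul_zero]; rw [Finset.card_erase_of_mem h]
    have := Finset.card_pos.2 ⟨j, h⟩
    omega
  · rfl

lemma ksupp_kdf {p : ℕ} {g : Finset σ → M} (hg : ksupp (p+1) g) (z : σ → S) :
    ksupp p (kdf z g) := by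
  intro A hA
  rw [kdf_apply]
  exact Finset.sum_eq_zero fun j _ => by rw [ksupp_kio hg j A hA, smul_zero]

lemma kdf_ksupp_zero {g : Finset σ → M} (hg : ksupp 0 g) (z : σ → S) : kdf z g = 0 := by
  ext A
  rw [kdf_apply]
  refine Finset.sum_eq_zero fun j _ => ?_
  rw [kio_apply]
  split_ifs with h
  · simp
  · rw [hg, smul_zero, smul_zero]; simp

end Koszul


section Exact
variable {σ : Type*} [LinearOrder σ] [Fintype σ] {K : Type*} [Field K] {ι : Type*}

/-- coordinatewise division by a variable -/
noncomputable def kdiv (j : σ) : (ι → MvPolynomial σ K) →+ (ι → MvPolynomial σ K) where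
  toFun v i := (v i).divMonomial (Finsupp.single j 1)
  map_zero' := by ext i; simp
  map_add' v w := by ext i; simp [add_divMonomial]

/-- coordinatewise remainder -/
noncomputable def krem (j : σ) (v : ι → MvPolynomial σ K) : ι → MvPolynomial σ K :=
  fun i => (v i).modMonomial (Finsupp.single j 1)

lemma kdiv_X_self (j : σ) (v : ι → MvPolynomial σ K) :
    kdiv j ((X j : MvPolynomial σ K) • v) = v := by
  ext1 i
  exact X_mul_divMonomial j (v i)

lemma kdiv_X_ne (j k : σ) (h : k ≠ j) (v : ι → MvPolynomial σ K) :
    kdiv j ((X k : MvPolynomial σ K) • v) = (X k : MvPolynomial σ K) • kdiv j v := by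
  ext1 i
  ext m
  simp only [kdiv, AddMonoidHom.coe_mk, ZeroHom.coe_mk, Pi.smul_apply, smul_eq_mul]
  rw [coeff_divMonomial, coeff_X_mul', coeff_X_mul']
  have : (k ∈ (Finsupp.single j 1 + m).support) ↔ k ∈ m.support := by
    simp [h.symm]
  by_cases hk : k ∈ m.support
  · rw [if_pos (this.2 hk), if_pos hk, coeff_divMonomial]
    congr 1
    ext l
    simp only [Finsupp.coe_tsub, Finsupp.coe_add, Pi.sub_apply, Pi.add_apply, Finsupp.single_apply]
    have : m k ≠ 0 := by simpa using hk
    split_ifs <;> grind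
  · rw [if_neg (fun h' => hk (this.1 h')), if_neg hk]

lemma kdiv_add_krem (j : σ) (v : ι → MvPolynomial σ K) :
    (X j : MvPolynomial σ K) • kdiv j v + krem j v = v := by
  ext1 i
  exact divMonomial_add_modMonomial_single (v i) j

lemma kdf_step (j : σ) (g : Finset σ → ι → MvPolynomial σ K)
    (hg : kdf (X : σ → MvPolynomial σ K) g = 0) (A : Finset σ) :
    (g - kdf (X : σ → MvPolynomial σ K) (kwe j (fun A => kdiv j (g A)))) A =
      if j ∈ A then 0 else krem j (g A) := by
  have h0 : kdf (X : σ → MvPolynomial σ K) (fun A => kdiv j (g A)) =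
      fun A => - krem j (kio j g A) := by
    ext1 A
    have h1 : kdiv j (kdf (X : σ → MvPolynomial σ K) g A) = 0 := by rw [hg]; simp
    rw [kdf_apply, map_sum] at h1
    rw [kdf_apply]
    simp only [kio_map]
    rw [← sub_zero (∑ _, _), ← h1, ← Finset.sum_sub_distrib,
      Finset.sum_eq_single j]
    · rw [kdiv_X_self, sub_eq_iff_eq_add]
      nth_rewrite 3 [← kdiv_add_krem j (kio j g A)]
      abel
    · intro k _ hk
      rw [kdiv_X_ne j k hk, sub_self]
    · simp
  rw [kdf_kwe, h0, Pi.sub_apply, Pi.sub_apply]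
  have hrem : ∀ v : ι → MvPolynomial σ K, krem j v = v - (X j : MvPolynomial σ K) • kdiv j v :=
    fun v => by rw [eq_sub_iff_add_eq, add_comm, kdiv_add_krem]
  simp only [kwe_apply]
  split_ifs with hj
  · simp only [kio_apply, Finset.mem_erase, ne_eq, not_true_eq_false, false_and, if_false,
      Finset.insert_erase hj, ksgn_erase_self]
    have : ∀ v : ι → MvPolynomial σ K, krem j (ksgn j A • v) = ksgn j A • krem j v := by
      intro v; rw [hrem, hrem, map_zsmul, smul_sub, smul_comm]
    rw [this, smul_neg, smul_smul, ksgn_mul_self, one_smul, hrem]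
    abel
  · rw [hrem]; abel

lemma koszul_exact (p : ℕ) (g : Finset σ → ι → MvPolynomial σ K) (hs : ksupp p g)
    (hg : kdf (X : σ → MvPolynomial σ K) g = 0) (h0 : ∀ i, coeff 0 (g ∅ i) = 0) :
    ∃ u : Finset σ → ι → MvPolynomial σ K, ksupp (p+1) u ∧
      kdf (X : σ → MvPolynomial σ K) u = g := by
  classical
  have key : ∀ B : Finset σ, ∃ u : Finset σ → ι → MvPolynomial σ K, ksupp (p+1) u ∧
      (∀ i, coeff 0 ((g - kdf (X : σ → MvPolynomial σ K) u) ∅ i) = 0) ∧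
      ∀ j ∈ B, ∀ A, (j ∈ A → (g - kdf (X : σ → MvPolynomial σ K) u) A = 0) ∧
        ∀ i m, coeff m ((g - kdf (X : σ → MvPolynomial σ K) u) A i) ≠ 0 → m j = 0 := by
    intro B
    induction B using Finset.induction_on with
    | empty => exact ⟨0, fun _ _ => rfl, by simpa using h0, by simp⟩
    | insert j B hj ih =>
      obtain ⟨u, hu, hu0, huB⟩ := ih
      set g' := g - kdf (X : σ → MvPolynomial σ K) u with hg'
      have hdg' : kdf (X : σ → MvPolynomial σ K) g' = 0 := by
        rw [hg', map_sub, hg, kdf_kdf, sub_zero]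
      have hg's : ksupp p g' := hs.sub (ksupp_kdf hu _)
      have hstep := kdf_step j g' hdg'
      refine ⟨u + kwe j (fun A => kdiv j (g' A)), ?_, ?_, ?_⟩
      · intro A hA
        rw [Pi.add_apply, hu A hA, zero_add]
        refine ksupp_kwe (p := p) ?_ j A hA
        intro A hA
        change kdiv j (g' A) = 0
        rw [hg's A hA, map_zero]
      all_goals
        rw [map_add, ← sub_sub, ← hg']
        simp only [hstep]
      · intro i
        simp only [Finset.notMem_empty, if_false, krem]
        rw [coeff_modMonomial_of_not_le]
        · exact hu0 i
        · intro h
          have := h j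
          simp at this
      · intro l hl A
        rw [Finset.mem_insert] at hl
        constructor
        · intro hlA
          split_ifs with hjA
          · rfl
          · rcases hl with rfl | hl
            · exact absurd hlA hjA
            · rw [(huB l hl A).1 hlA]
              ext1 i
              simp only [krem, Pi.zero_apply]
              ext m
              by_cases hm : Finsupp.single j 1 ≤ m
              · rw [coeff_modMonomial_of_le _ hm]; simp
              · rw [coeff_modMonomial_of_not_le _ hm]
        · intro i m
          split_ifs with hjA
          · simp
          · simp only [krem]
            by_cases hm : Finsupp.single j 1 ≤ m
            · rw [coeff_modMonomial_of_le _ hm]; simp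
            · rw [coeff_modMonomial_of_not_le _ hm]
              intro hne
              rcases hl with rfl | hl
              · by_contra hml
                apply hm
                rw [Finsupp.single_le_iff]
                omega
              · exact (huB l hl A).2 i m hne
  obtain ⟨u, hu, hu0, huB⟩ := key Finset.univ
  refine ⟨u, hu, ?_⟩
  symm
  rw [← sub_eq_zero]
  ext1 A
  rcases A.eq_empty_or_nonempty with rfl | ⟨j, hj⟩
  · ext1 i
    ext m
    by_contra hne
    have hm : m = 0 := by
      ext j
      exact (huB j (Finset.mem_univ _) ∅).2 i m (by simpa using hne)
    subst hm
    exact hne (by simpa using hu0 i)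
  · exact (huB j (Finset.mem_univ _) A).1 hj

end Exact


section Homog
variable {σ : Type*} {K : Type*} [Field K] {ι κ : Type*}

/-- twisted homogeneous of degree e -/
def TwHom (tw : ι → ℕ) (e : ℕ) (v : ι → MvPolynomial σ K) : Prop :=
  ∀ r m, coeff m (v r) ≠ 0 → m.degree + tw r = e

/-- twisted homogeneous component -/
noncomputable def thc (tw : ι → ℕ) (e : ℕ) (v : ι → MvPolynomial σ K) : ι → MvPolynomial σ K :=
  fun r => if tw r ≤ e then homogeneousComponent (e - tw r) (v r) else 0

lemma coeff_thc (tw : ι → ℕ) (e : ℕ) (v : ι → MvPolynomial σ K) (r : ι) (m : σ →₀ ℕ) :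
    coeff m (thc tw e v r) = if m.degree + tw r = e then coeff m (v r) else 0 := by
  unfold thc
  by_cases h : tw r ≤ e
  · rw [if_pos h, coeff_homogeneousComponent]
    congr 1
    apply propext; omega
  · rw [if_neg h, if_neg (by omega), coeff_zero]

lemma thc_twHom (tw : ι → ℕ) (e : ℕ) (v : ι → MvPolynomial σ K) : TwHom tw e (thc tw e v) := by
  intro r m
  rw [coeff_thc]
  split_ifs with h <;> simp [h]

lemma TwHom.thc_eq {tw : ι → ℕ} {e : ℕ} {v : ι → MvPolynomial σ K} (h : TwHom tw e v) :
    thc tw e v = v := by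
  ext1 r; ext m
  rw [coeff_thc]
  split_ifs with h'
  · rfl
  · by_contra hne
    exact h' (h r m (Ne.symm hne))

lemma twHom_iff_mat (tw : ι → ℕ) (e : ℕ) (v : ι → MvPolynomial σ K) :
    TwHom tw e v ↔ ∀ r, if tw r ≤ e then (v r).IsHomogeneous (e - tw r) else v r = 0 := by
  constructor
  · intro h r
    split_ifs with hr
    · intro m hm
      have := h r m hm
      have h3 : Finsupp.weight 1 m = m.degree :=
        (DFunLike.congr_fun Finsupp.degree_eq_weight_one m).symm
      rw [h3]
      omega
    · ext m
      by_contra hne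
      have := h r m (by simpa using hne)
      omega
  · intro h r m hm
    have := h r
    split_ifs at this with hr
    · have h2 := this hm
      have h3 : Finsupp.weight 1 m = m.degree :=
        (DFunLike.congr_fun Finsupp.degree_eq_weight_one m).symm
      rw [h3] at h2
      omega
    · rw [this] at hm; simp at hm

lemma thc_lin [Fintype κ] (tw : ι → ℕ) (tw' : κ → ℕ) (g : κ → ι → MvPolynomial σ K)
    (hg : ∀ c, TwHom tw (tw' c) (g c)) (e : ℕ) (w : κ → MvPolynomial σ K) :
    thc tw e (Fintype.linearCombination (MvPolynomial σ K) g w) =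
      Fintype.linearCombination (MvPolynomial σ K) g (thc tw' e w) := by
  classical
  ext1 r; ext m
  rw [coeff_thc]
  simp only [Fintype.linearCombination_apply, Finset.sum_apply, Pi.smul_apply, smul_eq_mul,
    coeff_sum, coeff_mul]
  have hterm : ∀ c, ∀ x ∈ Finset.HasAntidiagonal.antidiagonal m,
      coeff x.1 (thc tw' e w c) * coeff x.2 (g c r) =
        if m.degree + tw r = e then coeff x.1 (w c) * coeff x.2 (g c r) else 0 := by
    intro c x hx
    by_cases h0 : coeff x.2 (g c r) = 0
    · simp [h0]
    · have h1 := hg c r _ h0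
      rw [Finset.HasAntidiagonal.mem_antidiagonal] at hx
      have h2 : m.degree = x.1.degree + x.2.degree := by rw [← hx, map_add]
      rw [coeff_thc]
      by_cases h3 : m.degree + tw r = e
      · rw [if_pos h3, if_pos (by omega)]
      · rw [if_neg h3, if_neg (by omega), zero_mul]
  rw [Finset.sum_congr rfl fun c _ => Finset.sum_congr rfl (hterm c)]
  split_ifs <;> simp

lemma thc_add (tw : ι → ℕ) (e : ℕ) (v w : ι → MvPolynomial σ K) :
    thc tw e (v + w) = thc tw e v + thc tw e w := by
  ext1 r; ext m
  simp only [coeff_thc, Pi.add_apply, coeff_add]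
  split_ifs <;> simp

lemma sum_thc [Fintype ι] (tw : ι → ℕ) (v : ι → MvPolynomial σ K) :
    ∃ B, v = ∑ e ∈ Finset.range B, thc tw e v := by
  refine ⟨(∑ r, (tw r + (v r).totalDegree)) + 1, ?_⟩
  ext1 r; ext m
  rw [Finset.sum_apply, coeff_sum]
  simp only [coeff_thc]
  rw [Finset.sum_ite_eq]
  split_ifs with h
  · rfl
  · by_contra hne
    apply h
    rw [Finset.mem_range]
    have h1 : m.degree ≤ (v r).totalDegree := le_totalDegree (by simpa using hne)
    have h2 : tw r + (v r).totalDegree ≤ ∑ r, (tw r + (v r).totalDegree) :=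
      Finset.single_le_sum (f := fun r => tw r + (v r).totalDegree) (by simp) (Finset.mem_univ r)
    omega

end Homog

section Walk
variable {σ : Type*} [LinearOrder σ] [Fintype σ] {K : Type*} [Field K]

local notation "lin" => Fintype.linearCombination (MvPolynomial σ K)

lemma twHom_kdf {ι : Type*} {tw : ι → ℕ} {e : ℕ} {g : Finset σ → ι → MvPolynomial σ K}
    (hg : ∀ A, TwHom tw e (g A)) (A : Finset σ) :
    TwHom tw (e+1) (kdf (X : σ → MvPolynomial σ K) g A) := by
  intro r m hm
  rw [kdf_apply, Finset.sum_apply, coeff_sum] at hm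
  obtain ⟨j, -, hj⟩ := Finset.exists_ne_zero_of_sum_ne_zero hm
  rw [Pi.smul_apply, smul_eq_mul, coeff_X_mul', kio_apply] at hj
  by_cases hjm : j ∈ m.support
  · rw [if_pos hjm] at hj
    by_cases hjA : j ∈ A
    · simp [hjA] at hj
    · rw [if_neg hjA] at hj
      have hne : coeff (m - Finsupp.single j 1) (g (insert j A) r) ≠ 0 := by
        intro h0
        apply hj
        rw [Pi.smul_apply, coeff_smul, h0, smul_zero]
      have := hg _ r _ hne
      have hle : Finsupp.single j 1 ≤ m := by
        rw [Finsupp.single_le_iff]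
        have : m j ≠ 0 := by simpa using hjm
        omega
      have h2 : m.degree = (m - Finsupp.single j 1).degree + 1 := by
        conv_lhs => rw [← tsub_add_cancel_of_le hle]
        rw [map_add, Finsupp.degree_single]
      omega
  · simp [hjm] at hj

lemma lower_walk (rk : ℕ → ℕ) (tw : (i : ℕ) → Fin (rk i) → ℕ)
    (D : (i : ℕ) → Fin (rk (i+1)) → Fin (rk i) → MvPolynomial σ K)
    (hD : ∀ i c, TwHom (tw i) (tw (i+1) c) (D i c))
    (hex : ∀ i v, lin (D i) v = 0 ↔ ∃ w, v = lin (D (i+1)) w) :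
    ∀ (p i e : ℕ) (_ : ∀ r, tw (i + p) r < e + p)
      (g : Finset σ → Fin (rk i) → MvPolynomial σ K) (_ : ksupp p g)
      (_ : ∀ A, TwHom (tw i) e (g A))
      (_ : ∀ A, ∃ w, kdf (X : σ → MvPolynomial σ K) g A = lin (D i) w),
      ∃ (b : Finset σ → Fin (rk i) → MvPolynomial σ K)
        (b' : Finset σ → Fin (rk (i+1)) → MvPolynomial σ K), ksupp (p+1) b ∧
        g = kdf (X : σ → MvPolynomial σ K) b + fun A => lin (D i) (b' A) := by
  intro p
  induction p with
  | zero =>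
    intro i e htw g hs hh _
    obtain ⟨u, hu, rfl⟩ := koszul_exact 0 g hs (kdf_ksupp_zero hs _) (by
      intro r
      by_contra hne
      have := hh ∅ r 0 hne
      have h2 := htw r
      simp at this
      simp at h2
      omega)
    refine ⟨u, 0, hu, ?_⟩
    ext1 A; simp
  | succ p ih =>
    intro i e htw g hs hh hw
    choose w hw using hw
    classical
    set g' : Finset σ → Fin (rk (i+1)) → MvPolynomial σ K :=
      fun A => if A.card = p then thc (tw (i+1)) (e+1) (w A) else 0 with hg'
    have hdg' : ∀ A, lin (D i) (g' A) = kdf (X : σ → MvPolynomial σ K) g A := by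
      intro A
      simp only [hg']
      split_ifs with hA
      · rw [← thc_lin (tw i) (tw (i+1)) (D i) (hD i), ← hw A, (twHom_kdf hh A).thc_eq]
      · rw [ksupp_kdf hs _ A hA, map_zero]
    have hdg'2 : (fun A => lin (D i) (g' A)) = kdf (X : σ → MvPolynomial σ K) g := funext hdg'
    obtain ⟨b', b'', hb', hb''⟩ := ih (i+1) (e+1) (by
        intro r
        have h1 : i + 1 + p = i + (p+1) := by omega
        revert r
        rw [h1]
        intro r
        have := htw r
        omega) g' (by
        intro A hA
        simp only [hg', if_neg hA]) (by
        intro A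
        simp only [hg']
        split_ifs
        · exact thc_twHom _ _ _
        · intro r m; simp) (by
        intro A
        rw [← hex]
        have h1 := congrFun (kdf_map (X : σ → MvPolynomial σ K) (lin (D i)) g') A
        rw [← h1, hdg'2, kdf_kdf, Pi.zero_apply])
    have hdb' : kdf (X : σ → MvPolynomial σ K) (g - fun A => lin (D i) (b' A)) = 0 := by
      rw [map_sub, ← hdg'2, kdf_map, sub_eq_zero]
      ext1 A
      rw [hb'', Pi.add_apply, map_add]
      have : lin (D i) (lin (D (i+1)) (b'' A)) = 0 := (hex i _).2 ⟨_, rfl⟩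
      rw [this, add_zero]
    have hsupp : ksupp (p+1) (g - fun A => lin (D i) (b' A)) := by
      refine hs.sub ?_
      intro A hA
      change lin (D i) (b' A) = 0
      rw [hb' A hA, map_zero]
    obtain ⟨u, hu, hu'⟩ := koszul_exact (p+1) _ hsupp hdb' (by
      intro r
      rw [hsupp ∅ (by simp)]; simp)
    exact ⟨u, b', hu, by rw [hu']; abel⟩

lemma upper_walk (rk : ℕ → ℕ)
    (D : (i : ℕ) → Fin (rk (i+1)) → Fin (rk i) → MvPolynomial σ K)
    (hex : ∀ i v, lin (D i) v = 0 ↔ ∃ w, v = lin (D (i+1)) w) :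
    ∀ (i p : ℕ) (_ : Fintype.card σ ≤ p + i + 1)
      (u : Finset σ → Fin (rk (i+1)) → MvPolynomial σ K) (_ : ksupp (p+1) u)
      (_ : kdf (X : σ → MvPolynomial σ K) (fun A => lin (D i) (u A)) = 0),
      ∃ (b : Finset σ → Fin (rk (i+1)) → MvPolynomial σ K)
        (b' : Finset σ → Fin (rk (i+2)) → MvPolynomial σ K),
        u = kdf (X : σ → MvPolynomial σ K) b + fun A => lin (D (i+1)) (b' A) := by
  intro i
  induction i with
  | zero =>
    intro p hp u hu hdu
    have hsupp : ksupp (p+1) (fun A => lin (D 0) (u A)) := by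
      intro A hA
      change lin (D 0) (u A) = 0
      rw [hu A hA, map_zero]
    obtain ⟨v, hv, hv'⟩ := koszul_exact (p+1) _ hsupp hdu (by
      intro r
      have := hsupp ∅ (by simp)
      simp only at this
      rw [this]; simp)
    have hv0 : v = 0 := by
      ext1 A
      apply hv
      have := A.card_le_univ
      omega
    rw [hv0, map_zero] at hv'
    have : ∀ A, ∃ w, u A = lin (D 1) w := fun A => (hex 0 _).1 (congrFun hv' A).symm
    choose w hw using this
    exact ⟨0, w, by ext1 A; simp [hw]⟩
  | succ i ih =>
    intro p hp u hu hdu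
    have hsupp : ksupp (p+1) (fun A => lin (D (i+1)) (u A)) := by
      intro A hA
      change lin (D (i+1)) (u A) = 0
      rw [hu A hA, map_zero]
    obtain ⟨v, hv, hv'⟩ := koszul_exact (p+1) _ hsupp hdu (by
      intro r
      have := hsupp ∅ (by simp)
      simp only at this
      rw [this]; simp)
    obtain ⟨w, w', rfl⟩ := ih (p+1) (by omega) v hv (by
      rw [kdf_map, hv']
      ext1 A
      exact (hex i _).2 ⟨_, rfl⟩)
    rw [map_add, kdf_kdf, zero_add, kdf_map] at hv'
    have : ∀ A, ∃ y, (u A - kdf (X : σ → MvPolynomial σ K) w' A) = lin (D (i+2)) y := by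
      intro A
      rw [← hex, map_sub, sub_eq_zero]
      exact (congrFun hv' A).symm
    choose y hy using this
    refine ⟨w', y, ?_⟩
    ext1 A
    rw [Pi.add_apply, ← hy]; abel

/-- Minimal resolutions terminate. -/
lemma minimal_terminates (rk : ℕ → ℕ)
    (D : (i : ℕ) → Fin (rk (i+1)) → Fin (rk i) → MvPolynomial σ K)
    (hex : ∀ i v, lin (D i) v = 0 ↔ ∃ w, v = lin (D (i+1)) w)
    (hmin : ∀ i v, lin (D i) v = 0 → ∀ c, coeff 0 (v c) = 0)
    (i : ℕ) (hi : Fintype.card σ ≤ i + 1) : rk (i+2) = 0 := by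
  classical
  by_contra hne
  let c : Fin (rk (i+2)) := ⟨0, Nat.pos_of_ne_zero hne⟩
  set x := lin (D (i+1)) (Pi.single c 1) with hx
  have hdx : lin (D i) x = 0 := (hex i _).2 ⟨_, rfl⟩
  let g : Finset σ → Fin (rk (i+1)) → MvPolynomial σ K := fun A => if A = ∅ then x else 0
  have hs : ksupp 0 g := by
    intro A hA
    simp only [g]
    rw [if_neg]
    rintro rfl
    simp at hA
  obtain ⟨u, hu, hug⟩ := koszul_exact 0 g hs (kdf_ksupp_zero hs _) (by
    intro r
    simp only [g, if_true]
    exact hmin i x hdx r)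
  obtain ⟨b, b', rfl⟩ := upper_walk rk D hex i 0 (by omega) u hu (by
    rw [kdf_map, hug]
    ext1 A
    simp only [g]
    split_ifs
    · exact hdx
    · simp)
  rw [map_add, kdf_kdf, zero_add, kdf_map] at hug
  have h1 := congrFun hug ∅
  simp only [g, if_true] at h1
  rw [hx, ← sub_eq_zero, ← map_sub] at h1
  have h2 := hmin _ _ h1 c
  rw [Pi.sub_apply, coeff_sub, Pi.single_eq_same, kdf_apply, Finset.sum_apply, coeff_sum] at h2
  rw [Finset.sum_eq_zero] at h2
  · simp at h2
  · intro j _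
    rw [Pi.smul_apply, smul_eq_mul, coeff_X_mul']
    simp

end Walk


section MinGens
variable {σ : Type*} [Finite σ] {K : Type*} [Field K]

local notation "lin" => Fintype.linearCombination (MvPolynomial σ K)

lemma exists_hom_gens {r : ℕ} (tw : Fin r → ℕ)
    (Z : Submodule (MvPolynomial σ K) (Fin r → MvPolynomial σ K))
    (hZ : ∀ v ∈ Z, ∀ e, thc tw e v ∈ Z) :
    ∃ (s : ℕ) (tw' : Fin s → ℕ) (g : Fin s → Fin r → MvPolynomial σ K),
      (∀ c, TwHom tw (tw' c) (g c)) ∧ Submodule.span (MvPolynomial σ K) (Set.range g) = Z := by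
  classical
  set H : Set (Fin r → MvPolynomial σ K) := {v | v ∈ Z ∧ ∃ e, TwHom tw e v} with hH
  have hspan : Submodule.span (MvPolynomial σ K) H = Z := by
    apply le_antisymm
    · rw [Submodule.span_le]
      exact fun v hv => hv.1
    · intro v hv
      obtain ⟨B, hB⟩ := sum_thc tw v
      rw [hB]
      exact Submodule.sum_mem _ fun e _ =>
        Submodule.subset_span ⟨hZ v hv e, e, thc_twHom _ _ _⟩
  have hfg : (Submodule.span (MvPolynomial σ K) H).FG := IsNoetherian.noetherian _
  rw [Submodule.fg_span_iff_fg_span_finset_subset] at hfg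
  obtain ⟨s', hs', hsp⟩ := hfg
  let e := s'.equivFin
  have hh : ∀ c : Fin s'.card, ∃ d, TwHom tw d (e.symm c : Fin r → MvPolynomial σ K) :=
    fun c => (hs' (e.symm c).2).2
  choose d hd using hh
  refine ⟨s'.card, d, fun c => (e.symm c : Fin r → MvPolynomial σ K), hd, ?_⟩
  rw [← hspan, hsp]
  congr 1
  ext v
  constructor
  · rintro ⟨c, rfl⟩
    exact (e.symm c).2
  · intro hv
    exact ⟨e ⟨v, hv⟩, by simp⟩

lemma exists_min_gens {r : ℕ} (tw : Fin r → ℕ)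
    (Z : Submodule (MvPolynomial σ K) (Fin r → MvPolynomial σ K))
    (hZ : ∀ v ∈ Z, ∀ e, thc tw e v ∈ Z) :
    ∃ (s : ℕ) (tw' : Fin s → ℕ) (g : Fin s → Fin r → MvPolynomial σ K),
      (∀ c, TwHom tw (tw' c) (g c)) ∧ (∀ v, v ∈ Z ↔ ∃ w, v = lin g w) ∧
      ∀ w, lin g w = 0 → ∀ c, coeff 0 (w c) = 0 := by
  classical
  have hex := exists_hom_gens tw Z hZ
  obtain ⟨tw', g, hg, hsp⟩ := Nat.find_spec hex
  have hmin : ∀ m < Nat.find hex, _ := fun m hm => Nat.find_min hex hm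
  revert tw' g hmin
  generalize Nat.find hex = s
  intro tw' g hg hsp hmin
  refine ⟨s, tw', g, hg, ?_, ?_⟩
  · intro v
    rw [← hsp, ← Fintype.range_linearCombination, LinearMap.mem_range]
    exact ⟨fun ⟨w, hw⟩ => ⟨w, hw.symm⟩, fun ⟨w, hw⟩ => ⟨w, hw.symm⟩⟩
  · intro w hw c
    by_contra hne
    have h1 : lin g (thc tw' (tw' c) w) = 0 := by
      rw [← thc_lin tw tw' g hg, hw]
      ext1 r; ext m
      rw [coeff_thc]; simp
    have h2 : thc tw' (tw' c) w c = C (coeff 0 (w c)) := by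
      simp [thc]
    cases s with
    | zero => exact c.elim0
    | succ s =>
      apply hmin s (Nat.lt_succ_self s)
      refine ⟨tw' ∘ c.succAbove, g ∘ c.succAbove, fun _ => hg _, ?_⟩
      rw [← hsp]
      apply le_antisymm
      · exact Submodule.span_mono (Set.range_comp_subset_range _ _)
      · rw [Submodule.span_le]
        rintro _ ⟨j, rfl⟩
        rcases eq_or_ne j c with rfl | hj
        · rw [Fintype.linearCombination_apply, Fin.sum_univ_succAbove _ j, h2] at h1
          have h3 : g j = - ((C (coeff 0 (w j))⁻¹ : MvPolynomial σ K) •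
              ∑ i, thc tw' (tw' j) w (j.succAbove i) • g (j.succAbove i)) := by
            rw [← smul_neg, ← eq_neg_of_add_eq_zero_left h1, smul_smul, ← C_mul,
              inv_mul_cancel₀ hne, C_1, one_smul]
          rw [h3]
          refine Submodule.neg_mem _ (Submodule.smul_mem _ _ (Submodule.sum_mem _ fun i _ =>
            Submodule.smul_mem _ _ (Submodule.subset_span ⟨i, rfl⟩)))
        · obtain ⟨i, rfl⟩ := Fin.exists_succAbove_eq hj
          exact Submodule.subset_span ⟨i, rfl⟩

variable (σ K) in
/-- One stage in the construction of a minimal resolution. -/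
structure ResState where
  r : ℕ
  tw : Fin r → ℕ
  Z : Submodule (MvPolynomial σ K) (Fin r → MvPolynomial σ K)
  hZ : ∀ v ∈ Z, ∀ e, thc tw e v ∈ Z

/-- rank of next stage -/
noncomputable def ResState.nr (s : ResState σ K) : ℕ := (exists_min_gens s.tw s.Z s.hZ).choose
/-- twists of next stage -/
noncomputable def ResState.ntw (s : ResState σ K) : Fin s.nr → ℕ :=
  (exists_min_gens s.tw s.Z s.hZ).choose_spec.choose
/-- generators of next stage -/
noncomputable def ResState.ng (s : ResState σ K) : Fin s.nr → Fin s.r → MvPolynomial σ K :=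
  (exists_min_gens s.tw s.Z s.hZ).choose_spec.choose_spec.choose
lemma ResState.spec (s : ResState σ K) : (∀ c, TwHom s.tw (s.ntw c) (s.ng c)) ∧
    (∀ v, v ∈ s.Z ↔ ∃ w, v = lin s.ng w) ∧ ∀ w, lin s.ng w = 0 → ∀ c, coeff 0 (w c) = 0 :=
  (exists_min_gens s.tw s.Z s.hZ).choose_spec.choose_spec.choose_spec

/-- next stage -/
noncomputable def ResState.next (s : ResState σ K) : ResState σ K where
  r := s.nr
  tw := s.ntw
  Z := LinearMap.ker (lin s.ng)
  hZ := by
    intro v hv e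
    rw [LinearMap.mem_ker] at hv ⊢
    rw [← thc_lin s.tw s.ntw s.ng s.spec.1, hv]
    ext1 r; ext m
    rw [coeff_thc]; simp

/-- the sequence of stages -/
noncomputable def resSeq (s : ResState σ K) : ℕ → ResState σ K
  | 0 => s
  | i+1 => (resSeq s i).next

theorem exists_resolution (J : Ideal (MvPolynomial σ K))
    (hJ : ∀ p ∈ J, ∀ e, homogeneousComponent e p ∈ J) :
    Nonempty (GradedFreeResolution (K := K) J) := by
  classical
  have := Fintype.ofFinite σ
  let _ : LinearOrder σ := LinearOrder.lift' (Fintype.equivFin σ) (Equiv.injective _)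
  let s0 : ResState σ K :=
    { r := 1
      tw := fun _ => 0
      Z := Submodule.comap (LinearMap.proj (0 : Fin 1)) (J : Submodule _ _)
      hZ := by
        intro v hv e
        rw [Submodule.mem_comap] at hv ⊢
        simp only [LinearMap.proj_apply] at hv ⊢
        simpa [thc] using hJ _ hv e }
  let st := resSeq s0
  let D : (i : ℕ) → Fin (st (i+1)).r → Fin (st i).r → MvPolynomial σ K := fun i => (st i).ng
  have hex : ∀ i v, lin (D i) v = 0 ↔ ∃ w, v = lin (D (i+1)) w := fun i v =>
    (st (i+1)).spec.2.1 v
  have hmin : ∀ i v, lin (D i) v = 0 → ∀ c, coeff 0 (v c) = 0 := fun i => (st i).spec.2.2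
  have hlin : ∀ i v r, lin (D i) v r = ∑ c, D i c r * v c := by
    intro i v r
    rw [Fintype.linearCombination_apply, Finset.sum_apply]
    exact Finset.sum_congr rfl fun c _ => mul_comm _ _
  refine ⟨{ len := Fintype.card σ + 1
            rk := fun i => (st i).r
            tw := fun i => (st i).tw
            mat := fun i r c => D i c r
            aug := fun _ => 1
            finite := ?_
            aug_homog := ?_
            mat_homog := ?_
            aug_surj := ?_
            exact_zero := ?_
            exact_succ := ?_ }⟩
  · intro i hi
    obtain ⟨j, rfl⟩ : ∃ j, i = j + 2 := ⟨i - 2, by omega⟩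
    exact minimal_terminates (fun i => (st i).r) D hex hmin j (by omega)
  · intro r
    exact isHomogeneous_one _ _
  · intro i r c
    exact (twHom_iff_mat _ _ _).1 ((st i).spec.1 c) r
  · intro s
    refine ⟨fun _ => s, ?_⟩
    change s - ∑ r : Fin 1, 1 * s ∈ J
    simp
  · intro v
    have h1 := (st 0).spec.2.1 v
    have h2 : v ∈ (st 0).Z ↔ v (0 : Fin 1) ∈ J := Iff.rfl
    have h3 : ∑ r, (1 : MvPolynomial σ K) * v r = v (0 : Fin 1) := by
      have h4 : ∀ v : Fin 1 → MvPolynomial σ K, ∑ r : Fin 1, 1 * v r = v 0 := by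
        intro v; simp
      exact h4 v
    rw [h3, ← h2, h1]
    refine exists_congr fun w => ?_
    rw [_root_.funext_iff]
    refine forall_congr' fun r => ?_
    have h5 := hlin 0 w r
    exact ⟨fun h => h.trans h5, fun h => h.trans h5.symm⟩
  · intro i v
    have h1 := hex i v
    rw [_root_.funext_iff] at h1
    simp only [hlin, _root_.funext_iff, Pi.zero_apply] at h1
    exact h1

end MinGens


section Lower
variable {σ : Type*} [LinearOrder σ] [Fintype σ] {K : Type*} [Field K]

local notation "lin" => Fintype.linearCombination (MvPolynomial σ K)

theorem koszul_boundary_of_reg (J : Ideal (MvPolynomial σ K))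
    (hJ : ∀ p ∈ J, ∀ e, homogeneousComponent e p ∈ J)
    (F : GradedFreeResolution (K := K) J) (n e : ℕ) (hF : ∀ r, F.tw n r < e + n)
    (g : Finset σ → MvPolynomial σ K) (hs : ksupp n g) (hg : ∀ A, (g A).IsHomogeneous e)
    (hdg : ∀ A, kdf (X : σ → MvPolynomial σ K) g A ∈ J) :
    ∃ b : Finset σ → MvPolynomial σ K,
      ∀ A, g A - kdf (X : σ → MvPolynomial σ K) b A ∈ J := by
  classical
  let D : (i : ℕ) → Fin (F.rk (i+1)) → Fin (F.rk i) → MvPolynomial σ K := fun i c r => F.mat i r c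
  have hlin : ∀ i v r, lin (D i) v r = ∑ c, F.mat i r c * v c := by
    intro i v r
    rw [Fintype.linearCombination_apply, Finset.sum_apply]
    exact Finset.sum_congr rfl fun c _ => mul_comm _ _
  have hD : ∀ i c, TwHom (F.tw i) (F.tw (i+1) c) (D i c) := fun i c =>
    (twHom_iff_mat _ _ _).2 fun r => F.mat_homog i r c
  have hex : ∀ i v, lin (D i) v = 0 ↔ ∃ w, v = lin (D (i+1)) w := by
    intro i v
    simp only [hlin, _root_.funext_iff, Pi.zero_apply]
    exact F.exact_succ i v
  -- the augmentation as a linear map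
  let a : (Fin (F.rk 0) → MvPolynomial σ K) →ₗ[MvPolynomial σ K] MvPolynomial σ K :=
    Fintype.linearCombination (MvPolynomial σ K) F.aug
  have ha : ∀ v, a v = ∑ r, F.aug r * v r := by
    intro v
    simp only [a, Fintype.linearCombination_apply, smul_eq_mul]
    exact Finset.sum_congr rfl fun c _ => mul_comm _ _
  have hex0 : ∀ v, a v ∈ J ↔ ∃ w, v = lin (D 0) w := by
    intro v
    rw [ha]
    simp only [_root_.funext_iff, hlin]
    exact F.exact_zero v
  have hahom : ∀ v, a (thc (F.tw 0) e v) = homogeneousComponent e (a v) := by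
    intro v
    have := thc_lin (ι := Unit) (fun _ => 0) (F.tw 0) (fun c _ => F.aug c) (by
      intro c
      rw [twHom_iff_mat]
      intro _
      simpa using F.aug_homog c) e v
    have h2 := congrFun this ()
    simp only [thc, Fintype.linearCombination_apply, Finset.sum_apply, Pi.smul_apply,
      zero_le, if_true, Nat.sub_zero] at h2
    simp only [a, Fintype.linearCombination_apply, thc]
    exact h2.symm
  choose v hv using fun A => F.aug_surj (g A)
  simp only [← ha] at hv
  let c : Finset σ → Fin (F.rk 0) → MvPolynomial σ K :=
    fun A => if A.card = n then thc (F.tw 0) e (v A) else 0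
  have hc : ∀ A, g A - a (c A) ∈ J := by
    intro A
    simp only [c]
    split_ifs with h
    · rw [hahom]
      have h1 := hJ _ (hv A) e
      rwa [map_sub, homogeneousComponent_eq_self (hg A)] at h1
    · rw [hs A h]; simp
  have hJd : ∀ h : Finset σ → MvPolynomial σ K, (∀ A, h A ∈ J) →
      ∀ A, kdf (X : σ → MvPolynomial σ K) h A ∈ J := by
    intro h hh A
    rw [kdf_apply]
    refine Ideal.sum_mem _ fun j _ => ?_
    rw [smul_eq_mul]
    apply Ideal.mul_mem_left
    rw [kio_apply]
    split_ifs
    · exact J.zero_mem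
    · exact zsmul_mem (hh _) _
  obtain ⟨b, b', -, hb⟩ := lower_walk F.rk F.tw D hD hex n 0 e (by rw [Nat.zero_add]; exact hF) c (by
      intro A hA
      simp only [c, if_neg hA]) (by
      intro A
      simp only [c]
      split_ifs
      · exact thc_twHom _ _ _
      · intro r m; simp) (by
      intro A
      rw [← hex0]
      have h1 := congrFun (kdf_map (X : σ → MvPolynomial σ K) a c) A
      rw [← h1]
      have h2 := hJd (g - fun A => a (c A)) (fun A => hc A) A
      rw [map_sub, Pi.sub_apply] at h2
      exact (Submodule.sub_mem_iff_right _ (hdg A)).1 h2)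
  refine ⟨fun A => a (b A), fun A => ?_⟩
  have h1 := congrFun (kdf_map (X : σ → MvPolynomial σ K) a b) A
  rw [h1]
  have h2 := congrArg a (congrFun hb A)
  rw [Pi.add_apply, map_add] at h2
  have h3 : a (lin (D 0) (b' A)) ∈ J := (hex0 _).2 ⟨_, rfl⟩
  have h4 := J.add_mem (hc A) h3
  rw [h2] at h4
  convert h4 using 1
  ring

end Lower


section Target
variable {K : Type*} [Field K] {n : ℕ}

/-- `X l` for `l < n`, zero otherwise -/
noncomputable def zv (K : Type*) [Field K] (n : ℕ) (l : ℕ) : MvPolynomial (Fin n) K :=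
  if h : l < n then X ⟨l, h⟩ else 0

/-- `z_l ^ 2 - z_{l-1} z_{l+1}` -/
noncomputable def qv (K : Type*) [Field K] (n : ℕ) (l : ℕ) : MvPolynomial (Fin n) K :=
  zv K n l ^ 2 - (if l = 0 then 0 else zv K n (l-1)) * zv K n (l+1)

/-- concave weight -/
def wtl (n : ℕ) (l : ℕ) : ℕ := l * (2 * n - l)

/-- weight of a monomial -/
noncomputable def wtm {n : ℕ} (m : Fin n →₀ ℕ) : ℕ := Finsupp.weight (fun l : Fin n => wtl n l) m

/-- `p` is `z^m` plus terms of lower weight -/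
def Lead (m : Fin n →₀ ℕ) (p : MvPolynomial (Fin n) K) : Prop :=
  ∀ m', coeff m' (p - monomial m 1) ≠ 0 → wtm m' < wtm m

lemma wtm_add (m m' : Fin n →₀ ℕ) : wtm (m + m') = wtm m + wtm m' := map_add _ _ _

lemma wtm_single (l : Fin n) (a : ℕ) : wtm (Finsupp.single l a) = a * wtl n l := by
  simp [wtm, Finsupp.weight_single]

lemma Lead.le {m : Fin n →₀ ℕ} {p : MvPolynomial (Fin n) K} (h : Lead m p) (m' : Fin n →₀ ℕ)
    (hm : coeff m' p ≠ 0) : wtm m' ≤ wtm m := by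
  classical
  by_cases h' : m = m'
  · rw [h']
  · refine (h m' ?_).le
    rw [coeff_sub, coeff_monomial, if_neg h', sub_zero]
    exact hm

lemma lead_monomial (m : Fin n →₀ ℕ) : Lead m (monomial m (1 : K)) := by
  intro m' h; simp at h

lemma Lead.mul {m m' : Fin n →₀ ℕ} {p q : MvPolynomial (Fin n) K} (hp : Lead m p)
    (hq : Lead m' q) : Lead (m + m') (p * q) := by
  classical
  intro a ha
  have : p * q - monomial (m + m') 1 = (p - monomial m 1) * q + monomial m 1 * (q - monomial m' 1)
      := by
    have h1 : monomial (m + m') (1 : K) = monomial m 1 * monomial m' 1 := by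
      rw [monomial_mul, one_mul]
    rw [h1]; ring
  rw [this, coeff_add] at ha
  rw [wtm_add]
  have h2 : coeff a ((p - monomial m 1) * q) ≠ 0 ∨
      coeff a (monomial m 1 * (q - monomial m' 1)) ≠ 0 := by
    by_contra h
    push Not at h
    apply ha; rw [h.1, h.2, add_zero]
  rcases h2 with h2 | h2
  · rw [coeff_mul] at h2
    obtain ⟨x, hx, hx'⟩ := Finset.exists_ne_zero_of_sum_ne_zero h2
    rw [Finset.HasAntidiagonal.mem_antidiagonal] at hx
    have h3 := hp _ (left_ne_zero_of_mul hx')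
    have h4 := hq.le _ (right_ne_zero_of_mul hx')
    rw [← hx, wtm_add]; omega
  · rw [coeff_mul] at h2
    obtain ⟨x, hx, hx'⟩ := Finset.exists_ne_zero_of_sum_ne_zero h2
    rw [Finset.HasAntidiagonal.mem_antidiagonal] at hx
    have h3 := (lead_monomial (K := K) m).le _ (left_ne_zero_of_mul hx')
    have h4 := hq _ (right_ne_zero_of_mul hx')
    rw [← hx, wtm_add]; omega

lemma lead_one : Lead (0 : Fin n →₀ ℕ) (1 : MvPolynomial (Fin n) K) := lead_monomial 0

lemma Lead.pow {m : Fin n →₀ ℕ} {p : MvPolynomial (Fin n) K} (hp : Lead m p) (a : ℕ) :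
    Lead (a • m) (p ^ a) := by
  induction a with
  | zero => simpa using lead_one
  | succ a ih => rw [pow_succ, succ_nsmul]; exact ih.mul hp

lemma Lead.prod {ι : Type*} (s : Finset ι) (m : ι → Fin n →₀ ℕ)
    (p : ι → MvPolynomial (Fin n) K) (hp : ∀ i, Lead (m i) (p i)) :
    Lead (∑ i ∈ s, m i) (∏ i ∈ s, p i) := by
  classical
  induction s using Finset.induction_on with
  | empty => simpa using lead_one
  | insert i s hi ih => rw [Finset.sum_insert hi, Finset.prod_insert hi]; exact (hp i).mul ih

lemma lead_qv (l : Fin n) : Lead (Finsupp.single l 2) (qv K n l) := by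
  classical
  intro m hm
  have h1 : qv K n l - monomial (Finsupp.single l 2) 1 =
      -((if (l : ℕ) = 0 then 0 else zv K n (l-1)) * zv K n (l+1)) := by
    have : zv K n l ^ 2 = monomial (Finsupp.single l 2) (1 : K) := by
      rw [zv, dif_pos l.2, X_pow_eq_monomial]
    rw [qv, this]; ring
  rw [h1, coeff_neg, neg_ne_zero] at hm
  by_cases h0 : (l : ℕ) = 0
  · simp [h0] at hm
  by_cases hl : (l : ℕ) + 1 < n
  · rw [if_neg h0, zv, zv, dif_pos hl, dif_pos (by omega), X, X, monomial_mul, coeff_monomial] at hm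
    split_ifs at hm with h
    · rw [← h, wtm_add, wtm_single, wtm_single, wtm_single]
      simp only [wtl]
      obtain ⟨a, ha⟩ : ∃ a, (l : ℕ) = a + 1 := ⟨l - 1, by omega⟩
      obtain ⟨b, hb⟩ : ∃ b, n = a + 3 + b := ⟨n - (a+3), by omega⟩
      rw [ha, show 2 * n - (a + 1 - 1) = a + 6 + 2 * b by omega,
        show 2 * n - (a + 1 + 1) = a + 4 + 2 * b by omega,
        show 2 * n - (a + 1) = a + 5 + 2 * b by omega, show a + 1 - 1 = a by omega]
      nlinarith
    · simp at hm
  · simp [zv, hl] at hm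

/-- the element `q^{m/2} z^{m%2}` -/
noncomputable def Lmon (K : Type*) [Field K] {n : ℕ} (m : Fin n →₀ ℕ) : MvPolynomial (Fin n) K :=
  ∏ l : Fin n, (qv K n l ^ (m l / 2) * X l ^ (m l % 2))

lemma lead_Lmon (m : Fin n →₀ ℕ) : Lead m (Lmon K m) := by
  classical
  have h := Lead.prod Finset.univ
    (fun l : Fin n => (m l / 2) • Finsupp.single l 2 + (m l % 2) • Finsupp.single l 1)
    (fun l : Fin n => qv K n l ^ (m l / 2) * (X l : MvPolynomial (Fin n) K) ^ (m l % 2))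
    (fun l => ((lead_qv l).pow _).mul (Lead.pow (lead_monomial _) _))
  have h2 : ∑ l : Fin n, ((m l / 2) • Finsupp.single l 2 + (m l % 2) • Finsupp.single l 1) = m := by
    ext j
    rw [Finset.sum_apply', Finset.sum_eq_single j]
    · simp; omega
    · intro i _ hij
      simp [hij]
    · simp
  rw [h2] at h
  exact h

lemma Lmon_add (m : Fin n →₀ ℕ) (l : Fin n) :
    Lmon K (m + Finsupp.single l 2) = qv K n l * Lmon K m := by
  classical
  unfold Lmon
  rw [← Finset.mul_prod_erase _ _ (Finset.mem_univ l),
    ← Finset.mul_prod_erase Finset.univ (fun l : Fin n => qv K n l ^ (m l / 2) * X l ^ (m l % 2))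
      (Finset.mem_univ l)]
  have h1 : (m + Finsupp.single l 2 : Fin n →₀ ℕ) l / 2 = m l / 2 + 1 := by simp
  have h2 : (m + Finsupp.single l 2 : Fin n →₀ ℕ) l % 2 = m l % 2 := by simp
  rw [h1, h2, pow_succ]
  have h3 : ∀ x ∈ Finset.univ.erase l, qv K n x ^ ((m + Finsupp.single l 2 : Fin n →₀ ℕ) x / 2) *
      (X x : MvPolynomial (Fin n) K) ^ ((m + Finsupp.single l 2 : Fin n →₀ ℕ) x % 2) =
      qv K n x ^ (m x / 2) * X x ^ (m x % 2) := by
    intro x hx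
    have : x ≠ l := Finset.ne_of_mem_erase hx
    simp [this.symm]
  rw [Finset.prod_congr rfl h3]
  ring

/-- the linear map `z^m ↦ q^{m/2} z^{m%2}` -/
noncomputable def Lmap (K : Type*) [Field K] (n : ℕ) :
    MvPolynomial (Fin n) K →ₗ[K] MvPolynomial (Fin n) K :=
  (basisMonomials (Fin n) K).constr K (Lmon K)

lemma Lmap_monomial (m : Fin n →₀ ℕ) : Lmap K n (monomial m 1) = Lmon K m := by
  have := (basisMonomials (Fin n) K).constr_basis K (Lmon K) m
  rwa [coe_basisMonomials] at this

lemma Lmap_apply (p : MvPolynomial (Fin n) K) :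
    Lmap K n p = ∑ m ∈ p.support, coeff m p • Lmon K m := by
  conv_lhs => rw [p.as_sum]
  rw [map_sum]
  refine Finset.sum_congr rfl fun m _ => ?_
  rw [← Lmap_monomial, ← map_smul, smul_monomial, smul_eq_mul, mul_one]

lemma Lmap_inj (p : MvPolynomial (Fin n) K) (hp : Lmap K n p = 0) : p = 0 := by
  classical
  by_contra hne
  obtain ⟨m, hm, hmax⟩ := Finset.exists_max_image p.support wtm (by simpa using hne)
  have h1 : coeff m (Lmap K n p) = coeff m p := by
    rw [Lmap_apply, coeff_sum, Finset.sum_eq_single m]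
    · have : coeff m (Lmon K m) = 1 := by
        by_contra h
        have := lead_Lmon (K := K) m m (by
          rw [coeff_sub, coeff_monomial, if_pos rfl]; exact sub_ne_zero.2 h)
        omega
      rw [coeff_smul, this, smul_eq_mul, mul_one]
    · intro m' hm' hmm'
      rw [coeff_smul]
      have : coeff m (Lmon K m') = 0 := by
        by_contra h
        have := lead_Lmon (K := K) m' m (by
          rw [coeff_sub, coeff_monomial, if_neg hmm', sub_zero]; exact h)
        have := hmax m' hm'
        omega
      rw [this, smul_zero]
    · intro h; exact absurd hm h
  rw [hp, coeff_zero] at h1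
  exact (mem_support_iff.1 hm) h1.symm

lemma Lmap_surj_mon (w : ℕ) : ∀ m : Fin n →₀ ℕ, wtm m = w →
    monomial m (1 : K) ∈ LinearMap.range (Lmap K n) := by
  induction w using Nat.strong_induction_on with
  | _ w ih =>
    intro m hm
    have h1 : monomial m (1 : K) = Lmap K n (monomial m 1) - (Lmon K m - monomial m 1) := by
      rw [Lmap_monomial]; ring
    rw [h1]
    refine Submodule.sub_mem _ ⟨_, rfl⟩ ?_
    have h0 := MvPolynomial.as_sum (Lmon K m - monomial m (1:K))
    rw [h0]
    refine Submodule.sum_mem _ fun m' hm' => ?_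
    have h2 := lead_Lmon (K := K) m m' (mem_support_iff.1 hm')
    have h3 := ih _ (by omega) m' rfl
    have := Submodule.smul_mem _ (coeff m' (Lmon K m - monomial m 1)) h3
    rwa [smul_monomial, smul_eq_mul, mul_one] at this

lemma Lmap_surj (p : MvPolynomial (Fin n) K) : p ∈ LinearMap.range (Lmap K n) := by
  rw [p.as_sum]
  refine Submodule.sum_mem _ fun m _ => ?_
  have := Submodule.smul_mem _ (coeff m p) (Lmap_surj_mon (K := K) _ m rfl)
  rwa [smul_monomial, smul_eq_mul, mul_one] at this

/-- The ideal generated by the `q_l`. -/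
noncomputable def Qid (K : Type*) [Field K] (n : ℕ) : Ideal (MvPolynomial (Fin n) K) :=
  Ideal.span (Set.range fun l : Fin n => qv K n l)

/-- the set of polynomials with support in `∑ m/2 ≥ s` -/
def Bset (K : Type*) [Field K] (n s : ℕ) : Submodule K (MvPolynomial (Fin n) K) where
  carrier := {p | ∀ m, coeff m p ≠ 0 → s ≤ ∑ l, m l / 2}
  zero_mem' := by intro m h; simp at h
  add_mem' := by
    intro p q hp hq m hm
    by_cases h : coeff m p = 0
    · refine hq m fun h' => hm ?_
      rw [coeff_add, h, h', add_zero]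
    · exact hp m h
  smul_mem' := by
    intro c p hp m hm
    refine hp m fun h => hm ?_
    rw [coeff_smul, h, smul_zero]

lemma Bset_mul (s : ℕ) (l : Fin n) (p : MvPolynomial (Fin n) K)
    (hp : p ∈ (Bset K n s).map (Lmap K n)) :
    qv K n l * p ∈ (Bset K n (s+1)).map (Lmap K n) := by
  classical
  obtain ⟨r, hr, rfl⟩ := hp
  rw [Lmap_apply, Finset.mul_sum]
  refine Submodule.sum_mem _ fun m hm => ?_
  rw [mul_smul_comm, ← Lmon_add, ← Lmap_monomial]
  refine Submodule.smul_mem _ _ ⟨_, ?_, rfl⟩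
  intro m' hm'
  rw [coeff_monomial] at hm'
  split_ifs at hm' with h
  · subst h
    have h1 := hr m (mem_support_iff.1 hm)
    have h2 : ∑ x : Fin n, (m + Finsupp.single l 2 : Fin n →₀ ℕ) x / 2 = ∑ x : Fin n, (m x / 2 + if x = l then 1 else 0) := by
      refine Finset.sum_congr rfl fun x _ => ?_
      by_cases hx : x = l
      · subst hx; simp
      · simp [hx]
    rw [h2, Finset.sum_add_distrib]
    simpa using h1
  · simp at hm'

lemma Qid_pow_le (s : ℕ) : ∀ p ∈ Qid K n ^ s, p ∈ (Bset K n s).map (Lmap K n) := by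
  induction s with
  | zero =>
    intro p _
    obtain ⟨r, rfl⟩ := Lmap_surj p
    exact ⟨r, fun m _ => Nat.zero_le _, rfl⟩
  | succ s ih =>
    intro p hp
    rw [pow_succ'] at hp
    induction hp using Submodule.mul_induction_on' with
    | mem_mul_mem a ha b hb =>
      induction ha using Submodule.span_induction generalizing b with
      | mem x hx =>
        obtain ⟨l, rfl⟩ := hx
        exact Bset_mul s l _ (ih b hb)
      | zero => simp
      | add x y _ _ hx hy => rw [add_mul]; exact Submodule.add_mem _ (hx b hb) (hy b hb)
      | smul c x _ hx =>
        have : c • x * b = x * (c * b) := by rw [smul_eq_mul]; ring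
        rw [this]
        exact hx _ (Ideal.mul_mem_left _ _ hb)
    | add x _ y _ hx hy => exact Submodule.add_mem _ hx hy

lemma not_mem_Qid (t : ℕ) (hn : 0 < n) :
    qv K n 0 ^ t * ∏ l : Fin n, (X l : MvPolynomial (Fin n) K) ∉ Qid K n ^ (t+1) := by
  classical
  intro hmem
  let m : Fin n →₀ ℕ := Finsupp.equivFunOnFinite.symm
    (fun l => if l = ⟨0, hn⟩ then 2 * t + 1 else 1)
  have hm : ∀ l, m l = if l = ⟨0, hn⟩ then 2 * t + 1 else 1 := fun l => rfl
  have h1 : qv K n 0 ^ t * ∏ l : Fin n, (X l : MvPolynomial (Fin n) K) = Lmap K n (monomial m 1) := by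
    rw [Lmap_monomial, Lmon, Finset.prod_mul_distrib]
    congr 1
    · rw [Finset.prod_eq_single ⟨0, hn⟩]
      · rw [hm, if_pos rfl]
        congr 1; omega
      · intro l _ hl
        simp [hm, hl]
      · simp
    · refine Finset.prod_congr rfl fun l _ => ?_
      have : m l % 2 = 1 := by rw [hm]; split_ifs <;> omega
      rw [this, pow_one]
  rw [h1] at hmem
  obtain ⟨r, hr, hr'⟩ := Qid_pow_le _ _ hmem
  have h2 : r = monomial m 1 := by
    rw [← sub_eq_zero]
    apply Lmap_inj
    rw [map_sub, hr', sub_self]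
  subst h2
  have h3 := hr m (by simp)
  have h4 : ∑ l, m l / 2 = t := by
    rw [Finset.sum_eq_single ⟨0, hn⟩]
    · rw [hm, if_pos rfl]; omega
    · intro l _ hl
      simp [hm, hl]
    · simp
  omega

end Target


section Cycle
variable {σ : Type*} [LinearOrder σ] {K : Type*} [Field K]

lemma kio_smul (p : MvPolynomial σ K) (j : σ) (g : Finset σ → MvPolynomial σ K) :
    kio j (p • g) = p • kio j g :=
  kio_map (DistribSMul.toAddMonoidHom (MvPolynomial σ K) p) j g

lemma kwe_smul (p : MvPolynomial σ K) (j : σ) (g : Finset σ → MvPolynomial σ K) :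
    kwe j (p • g) = p • kwe j g :=
  kwe_map (DistribSMul.toAddMonoidHom (MvPolynomial σ K) p) j g

/-- wedge with the element `e_i` lifting the binomial `f_i` -/
noncomputable def kW (x y : ℕ → σ) (i : ℕ) (g : Finset σ → MvPolynomial σ K) :
    Finset σ → MvPolynomial σ K :=
  (X (x i) : MvPolynomial σ K) • kwe (y (i+1)) g - (X (x (i+1)) : MvPolynomial σ K) • kwe (y i) g

/-- the binomial -/
noncomputable def kf (K : Type*) [Field K] (x y : ℕ → σ) (i : ℕ) : MvPolynomial σ K :=
  X (x i) * X (y (i+1)) - X (x (i+1)) * X (y i)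

/-- the Koszul cycle -/
noncomputable def kcyc (K : Type*) [Field K] (x y : ℕ → σ) : ℕ → Finset σ → MvPolynomial σ K
  | 0 => fun A => if A = ∅ then 1 else 0
  | m+1 => kW x y m (kcyc K x y m)

lemma kcyc_ksupp [Fintype σ] (x y : ℕ → σ) (m : ℕ) : ksupp m (kcyc K x y m) := by
  induction m with
  | zero =>
    intro A hA
    have : A ≠ ∅ := by rintro rfl; simp at hA
    simp [kcyc, this]
  | succ m ih =>
    intro A hA
    have h1 := ksupp_kwe ih (y (m+1)) A hA
    have h2 := ksupp_kwe ih (y m) A hA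
    simp [kcyc, kW, h1, h2]

lemma kcyc_homog (x y : ℕ → σ) (m : ℕ) : ∀ A, (kcyc K x y m A).IsHomogeneous m := by
  induction m with
  | zero =>
    intro A
    simp only [kcyc]
    split_ifs
    · exact isHomogeneous_one _ _
    · exact isHomogeneous_zero _ _ _
  | succ m ih =>
    intro A
    have h1 : ∀ j, (kwe j (kcyc K x y m) A).IsHomogeneous m := by
      intro j
      rw [kwe_apply]
      split_ifs
      · exact (homogeneousSubmodule σ K m).toAddSubgroup.zsmul_mem (ih _) _
      · exact isHomogeneous_zero _ _ _
    simp only [kcyc, kW, Pi.sub_apply, Pi.smul_apply, smul_eq_mul]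
    rw [add_comm m 1]
    exact ((isHomogeneous_X _ _).mul (h1 _)).sub ((isHomogeneous_X _ _).mul (h1 _))

lemma kf_homog (x y : ℕ → σ) (i : ℕ) : (kf K x y i).IsHomogeneous 2 :=
  ((isHomogeneous_X _ _).mul (isHomogeneous_X _ _)).sub
    ((isHomogeneous_X _ _).mul (isHomogeneous_X _ _))

lemma kdf_smul' [Fintype σ] (p : MvPolynomial σ K) (g : Finset σ → MvPolynomial σ K) :
    kdf (X : σ → MvPolynomial σ K) (p • g) = p • kdf (X : σ → MvPolynomial σ K) g :=
  kdf_map X (LinearMap.lsmul (MvPolynomial σ K) (MvPolynomial σ K) p) g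

lemma kdf_kW [Fintype σ] (x y : ℕ → σ) (i : ℕ) (g : Finset σ → MvPolynomial σ K) :
    kdf (X : σ → MvPolynomial σ K) (kW x y i g) =
      kf K x y i • g - kW x y i (kdf (X : σ → MvPolynomial σ K) g) := by
  simp only [kW]
  rw [map_sub, kdf_smul', kdf_smul', kdf_kwe, kdf_kwe]
  ext1 A
  simp only [kf, Pi.sub_apply, Pi.smul_apply, smul_eq_mul]
  ring

lemma kwe_mem {I : Ideal (MvPolynomial σ K)} {g : Finset σ → MvPolynomial σ K}
    (h : ∀ A, g A ∈ I) (j : σ) (A : Finset σ) : kwe j g A ∈ I := by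
  rw [kwe_apply]
  split_ifs
  · exact zsmul_mem (h _) _
  · exact I.zero_mem

lemma kio_mem {I : Ideal (MvPolynomial σ K)} {g : Finset σ → MvPolynomial σ K}
    (h : ∀ A, g A ∈ I) (j : σ) (A : Finset σ) : kio j g A ∈ I := by
  rw [kio_apply]
  split_ifs
  · exact I.zero_mem
  · exact zsmul_mem (h _) _

lemma kdf_kcyc [Fintype σ] (x y : ℕ → σ) (I : Ideal (MvPolynomial σ K)) (m : ℕ)
    (hf : ∀ i < m, kf K x y i ∈ I) :
    ∀ A, kdf (X : σ → MvPolynomial σ K) (kcyc K x y m) A ∈ I := by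
  induction m with
  | zero =>
    intro A
    rw [kdf_ksupp_zero (kcyc_ksupp x y 0)]
    exact I.zero_mem
  | succ m ih =>
    intro A
    have ih' := ih fun i hi => hf i (by omega)
    rw [kcyc, kdf_kW]
    simp only [kW, Pi.sub_apply, Pi.smul_apply, smul_eq_mul]
    exact I.sub_mem (I.mul_mem_right _ (hf m (by omega)))
      (I.sub_mem (I.mul_mem_left _ (kwe_mem ih' _ _)) (I.mul_mem_left _ (kwe_mem ih' _ _)))

/-- contraction with a linear form -/
def kal {M : Type*} [AddCommGroup M] (x y : ℕ → σ) (l : ℕ) : (Finset σ → M) →+ (Finset σ → M) :=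
  kio (x l) + kio (y (l+1))

lemma kal_apply {M : Type*} [AddCommGroup M] (x y : ℕ → σ) (l : ℕ) (g : Finset σ → M) :
    kal x y l g = kio (x l) g + kio (y (l+1)) g := rfl

lemma kal_kal {M : Type*} [AddCommGroup M] (x y : ℕ → σ) (l m : ℕ) (g : Finset σ → M) :
    kal x y l (kal x y m g) = - kal x y m (kal x y l g) := by
  simp only [kal_apply, map_add]
  rw [kio_kio (x l) (x m), kio_kio (x l) (y (m+1)), kio_kio (y (l+1)) (x m),
    kio_kio (y (l+1)) (y (m+1))]
  abel

lemma kal_kal_self {M : Type*} [AddCommGroup M] (x y : ℕ → σ) (l : ℕ) (g : Finset σ → M) :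
    kal x y l (kal x y l g) = 0 := by
  simp only [kal_apply, map_add, kio_kio_self]
  rw [kio_kio (x l) (y (l+1))]
  abel

lemma kal_smul (x y : ℕ → σ) (l : ℕ) (p : MvPolynomial σ K) (g : Finset σ → MvPolynomial σ K) :
    kal x y l (p • g) = p • kal x y l g := by
  simp only [kal_apply, kio_smul, smul_add]

lemma kal_kW (x y : ℕ → σ) (n : ℕ) (hy : ∀ i ≤ n, ∀ j ≤ n, y i = y j → i = j)
    (hxy : ∀ i j, x i ≠ y j) (l i : ℕ) (hl : l < n) (hi : i < n)
    (g : Finset σ → MvPolynomial σ K) :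
    kal x y l (kW x y i g) = ((if l = i then X (x i) else 0) - (if l + 1 = i then X (x (i+1)) else 0)
      : MvPolynomial σ K) • g - kW x y i (kal x y l g) := by
  have h1 : kio (x l) (kW x y i g) = - kW x y i (kio (x l) g) := by
    simp only [kW]
    rw [map_sub, kio_smul, kio_smul, kio_kwe _ _ (hxy _ _), kio_kwe _ _ (hxy _ _)]
    simp only [smul_neg]; abel
  have h3 : kW x y i (kal x y l g) = kW x y i (kio (x l) g) + kW x y i (kio (y (l+1)) g) := by
    simp only [kW, kal_apply, map_add, smul_add]; abel
  have h2 : kio (y (l+1)) (kW x y i g) = ((if l = i then X (x i) else 0) -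
      (if l + 1 = i then X (x (i+1)) else 0) : MvPolynomial σ K) • g
      - kW x y i (kio (y (l+1)) g) := by
    simp only [kW]
    rw [map_sub, kio_smul, kio_smul]
    by_cases ha : l = i
    · subst ha
      have : y (l+1) ≠ y l := fun h => by have := hy _ (by omega) _ (by omega) h; omega
      rw [kio_kwe_self, kio_kwe _ _ this]
      simp only [smul_neg, smul_sub, if_true, Nat.succ_ne_self, if_false, sub_zero]; abel
    · have hne : y (l+1) ≠ y (i+1) := fun h => by
        have := hy _ (by omega) _ (by omega) h; omega
      rw [kio_kwe _ _ hne]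
      by_cases hb : l + 1 = i
      · subst hb
        rw [kio_kwe_self]
        simp only [smul_neg, smul_sub, if_true, ha, if_false, zero_sub, neg_smul]; abel
      · have hne' : y (l+1) ≠ y i := fun h => by
          have := hy _ (by omega) _ (by omega) h; omega
        rw [kio_kwe _ _ hne']
        simp only [smul_neg, if_neg ha, if_neg hb, sub_zero, zero_smul]; abel
  rw [kal_apply, h1, h2, h3]
  abel

lemma kW_zero (x y : ℕ → σ) (i : ℕ) : kW x y i (0 : Finset σ → MvPolynomial σ K) = 0 := by
  simp [kW]

lemma kal_kcyc_zero (x y : ℕ → σ) (n : ℕ) (hy : ∀ i ≤ n, ∀ j ≤ n, y i = y j → i = j)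
    (hxy : ∀ i j, x i ≠ y j) (m : ℕ) (hm : m ≤ n) : ∀ l, m ≤ l → l < n →
    kal x y l (kcyc K x y m) = 0 := by
  induction m with
  | zero =>
    intro l _ _
    have : ∀ j : σ, kio j (kcyc K x y 0) = 0 := by
      intro j; ext1 A
      rw [kio_apply]
      simp [kcyc]
    rw [kal_apply, this, this, add_zero]
  | succ m ih =>
    intro l hl hln
    rw [kcyc, kal_kW x y n hy hxy l m hln (by omega), ih (by omega) l (by omega) hln, kW_zero,
      if_neg (by omega), if_neg (by omega)]
    simp

lemma kal_kcyc (x y : ℕ → σ) (n : ℕ) (hy : ∀ i ≤ n, ∀ j ≤ n, y i = y j → i = j)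
    (hxy : ∀ i j, x i ≠ y j) (m : ℕ) (hm : m < n) :
    kal x y m (kcyc K x y (m+1)) = (X (x m) : MvPolynomial σ K) • kcyc K x y m := by
  rw [kcyc, kal_kW x y n hy hxy m m hm hm, kal_kcyc_zero x y n hy hxy m hm.le m le_rfl hm, kW_zero,
      if_pos rfl, if_neg (by omega)]
  simp

/-- iterated contraction -/
def kit {M : Type*} [AddCommGroup M] (x y : ℕ → σ) : ℕ → (Finset σ → M) →+ (Finset σ → M)
  | 0 => AddMonoidHom.id _
  | m+1 => (kit x y m).comp (kal x y m)

lemma kit_succ {M : Type*} [AddCommGroup M] (x y : ℕ → σ) (m : ℕ) (g : Finset σ → M) :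
    kit x y (m+1) g = kit x y m (kal x y m g) := rfl

lemma kit_smul (x y : ℕ → σ) (m : ℕ) : ∀ (p : MvPolynomial σ K) (g : Finset σ → MvPolynomial σ K),
    kit x y m (p • g) = p • kit x y m g := by
  induction m with
  | zero => intro p g; rfl
  | succ m ih => intro p g; rw [kit_succ, kit_succ, kal_smul, ih]

lemma kit_kcyc (x y : ℕ → σ) (n : ℕ) (hy : ∀ i ≤ n, ∀ j ≤ n, y i = y j → i = j)
    (hxy : ∀ i j, x i ≠ y j) (m : ℕ) (hm : m ≤ n) :
    kit x y m (kcyc K x y m) = (∏ l ∈ Finset.range m, X (x l) : MvPolynomial σ K) • kcyc K x y 0 := by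
  induction m with
  | zero => simp [kit]
  | succ m ih =>
    rw [kit_succ, kal_kcyc x y n hy hxy m (by omega), kit_smul, ih (by omega), smul_smul,
      Finset.prod_range_succ, mul_comm]

lemma kit_mem {I : Ideal (MvPolynomial σ K)} (x y : ℕ → σ) (m : ℕ) :
    ∀ g : Finset σ → MvPolynomial σ K, (∀ A, g A ∈ I) → ∀ A, kit x y m g A ∈ I := by
  induction m with
  | zero => intro g hg A; exact hg A
  | succ m ih =>
    intro g hg A
    rw [kit_succ]
    exact ih _ (fun B => I.add_mem (kio_mem hg _ _) (kio_mem hg _ _)) A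

lemma kal_kdf [Fintype σ] (x y : ℕ → σ) (l : ℕ) (g : Finset σ → MvPolynomial σ K) :
    kal x y l (kdf (X : σ → MvPolynomial σ K) g) =
      - kdf (X : σ → MvPolynomial σ K) (kal x y l g) := by
  simp only [kal_apply, kio_kdf, map_add]; abel

lemma kit_kdf [Fintype σ] (x y : ℕ → σ) (m : ℕ) : ∀ g : Finset σ → MvPolynomial σ K,
    kit x y m (kdf (X : σ → MvPolynomial σ K) g) =
      ((-1 : ℤ) ^ m) • kdf (X : σ → MvPolynomial σ K) (kit x y m g) := by
  induction m with
  | zero => intro g; simp [kit]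
  | succ m ih =>
    intro g
    rw [kit_succ, kal_kdf, map_neg, ih, kit_succ, pow_succ]
    simp

lemma kal_kit {M : Type*} [AddCommGroup M] (x y : ℕ → σ) (l m : ℕ) : ∀ g : Finset σ → M,
    kal x y l (kit x y m g) = ((-1 : ℤ) ^ m) • kit x y m (kal x y l g) := by
  induction m with
  | zero => intro g; simp [kit]
  | succ m ih =>
    intro g
    rw [kit_succ, ih, kal_kal, map_neg, kit_succ, pow_succ]
    simp

lemma kal_kit_zero {M : Type*} [AddCommGroup M] (x y : ℕ → σ) (l m : ℕ) (hl : l < m) :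
    ∀ g : Finset σ → M, kal x y l (kit x y m g) = 0 := by
  induction m with
  | zero => omega
  | succ m ih =>
    intro g
    rw [kit_succ]
    rcases Nat.lt_succ_iff_lt_or_eq.1 hl with h | rfl
    · exact ih h _
    · rw [kal_kit, kal_kal_self]; simp

/-- the specialization -/
noncomputable def kph (K : Type*) [Field K] (x y : ℕ → σ) (n : ℕ) :
    MvPolynomial σ K →ₐ[K] MvPolynomial (Fin n) K :=
  aeval fun j => ∑ l ∈ Finset.range n,
    ((if j = x l then zv K n l else 0) + (if j = y (l+1) then zv K n l else 0))

lemma kph_X (x y : ℕ → σ) (n : ℕ) (j : σ) : kph K x y n (X j) = ∑ l ∈ Finset.range n,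
    ((if j = x l then zv K n l else 0) + (if j = y (l+1) then zv K n l else 0)) := aeval_X _ _

lemma kph_kdf [Fintype σ] (x y : ℕ → σ) (n : ℕ) (h : Finset σ → MvPolynomial σ K)
    (A : Finset σ) :
    kph K x y n (kdf (X : σ → MvPolynomial σ K) h A) =
      ∑ l ∈ Finset.range n, zv K n l * kph K x y n (kal x y l h A) := by
  rw [kdf_apply, map_sum]
  simp only [smul_eq_mul, map_mul, kph_X, Finset.sum_mul, add_mul]
  rw [Finset.sum_comm]
  refine Finset.sum_congr rfl fun l _ => ?_
  rw [Finset.sum_add_distrib]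
  simp only [ite_mul, zero_mul, Finset.sum_ite_eq', Finset.mem_univ, if_true]
  rw [kal_apply, Pi.add_apply, map_add, mul_add]
  
lemma kph_kit_kdf [Fintype σ] (x y : ℕ → σ) (n : ℕ) (g : Finset σ → MvPolynomial σ K) :
    kph K x y n (kit x y n (kdf (X : σ → MvPolynomial σ K) g) ∅) = 0 := by
  rw [kit_kdf, Pi.smul_apply, map_zsmul, kph_kdf, Finset.sum_eq_zero, smul_zero]
  intro l hl
  rw [kal_kit_zero x y l n (Finset.mem_range.1 hl)]
  simp

theorem path_bound [Fintype σ] (x y : ℕ → σ) (n : ℕ) (hn : 0 < n)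
    (hx : ∀ i ≤ n, ∀ j ≤ n, x i = x j → i = j)
    (hy : ∀ i ≤ n, ∀ j ≤ n, y i = y j → i = j)
    (hxy : ∀ i j, x i ≠ y j) (J : Ideal (MvPolynomial σ K)) (t : ℕ)
    (hJ : ∀ p ∈ J ^ (t+1), ∀ e, homogeneousComponent e p ∈ J ^ (t+1))
    (hfJ : ∀ i < n, kf K x y i ∈ J)
    (hphJ : J.map (kph K x y n) ≤ Qid K n)
    (F : GradedFreeResolution (K := K) (J ^ (t+1))) (m : ℕ) (hF : ∀ r, F.tw n r ≤ m + n) :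
    2 * t + n ≤ m := by
  by_contra hlt
  have hphx : ∀ i < n, kph K x y n (X (x i)) = zv K n i := by
    intro i hi
    rw [kph_X, Finset.sum_eq_single i]
    · simp [hxy]
    · intro l hl hli
      have : x i ≠ x l := fun h => hli (hx _ hi.le _ (Finset.mem_range.1 hl).le h).symm
      simp [hxy, this]
    · intro h; exact absurd (Finset.mem_range.2 hi) h
  have hphq : kph K x y n (kf K x y 0) = qv K n 0 := by
    have h0 : kph K x y n (X (y 0)) = 0 := by
      rw [kph_X]
      refine Finset.sum_eq_zero fun l hl => ?_
      have : y 0 ≠ y (l+1) := fun h => by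
        have := hy _ (by omega) _ (by have := Finset.mem_range.1 hl; omega) h; omega
      simp [(hxy _ _).symm, this]
    have h1 : kph K x y n (X (y 1)) = zv K n 0 := by
      rw [kph_X, Finset.sum_eq_single 0]
      · simp [(hxy _ _).symm]
      · intro l hl hli
        have : y 1 ≠ y (l+1) := fun h => by
          have := hy _ (by omega) _ (by have := Finset.mem_range.1 hl; omega) h; omega
        simp [(hxy _ _).symm, this]
      · intro h; exact absurd (Finset.mem_range.2 hn) h
    rw [kf, map_sub, map_mul, map_mul, h0, zero_add, h1, hphx 0 hn, qv]
    simp [sq]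
  let c : Finset σ → MvPolynomial σ K := (kf K x y 0 ^ t) • kcyc K x y n
  obtain ⟨b, hb⟩ := koszul_boundary_of_reg (J ^ (t+1)) hJ F n (2 * t + n)
    (fun r => by have := hF r; omega) c (by
      intro A hA
      simp only [c, Pi.smul_apply, kcyc_ksupp x y n A hA, smul_zero]) (by
      intro A
      exact ((kf_homog x y 0).pow t).mul (kcyc_homog x y n A)) (by
      intro A
      simp only [c]
      rw [kdf_smul', Pi.smul_apply, smul_eq_mul, pow_succ]
      exact Ideal.mul_mem_mul (Ideal.pow_mem_pow (hfJ 0 hn) t) (kdf_kcyc x y J n hfJ A))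
  have h1 := kit_mem x y n (c - kdf (X : σ → MvPolynomial σ K) b) hb ∅
  have h2 := Ideal.mem_map_of_mem (kph K x y n) h1
  rw [map_sub, Pi.sub_apply, map_sub, kph_kit_kdf, sub_zero, Ideal.map_pow] at h2
  have h3 := Ideal.pow_right_mono hphJ (t+1) h2
  simp only [c] at h3
  rw [kit_smul, kit_kcyc x y n hy hxy n le_rfl, smul_smul, Pi.smul_apply, smul_eq_mul, map_mul,
    map_mul, map_pow, hphq, map_prod] at h3
  apply not_mem_Qid (K := K) t hn
  convert h3 using 1
  simp only [kcyc, if_true, map_one, mul_one]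
  congr 1
  rw [← Fin.prod_univ_eq_prod_range (fun i => kph K x y n (X (x i))) n]
  refine Finset.prod_congr rfl fun l _ => ?_
  rw [hphx l l.2, zv, dif_pos l.2]

end Cycle


section Graph
variable {V : Type*} {K : Type*} [Field K]

attribute [local instance] MvPolynomial.gradedAlgebra

lemma bei_pow_homog (G : SimpleGraph V) (t : ℕ) :
    ∀ p ∈ binomialEdgeIdeal K G ^ t, ∀ e, homogeneousComponent e p ∈ binomialEdgeIdeal K G ^ t := by
  have h1 : (binomialEdgeIdeal K G).IsHomogeneous (homogeneousSubmodule (V ⊕ V) K) := by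
    apply Ideal.homogeneous_span
    rintro f ⟨u, v, -, rfl⟩
    exact ⟨2, ((isHomogeneous_X K _).mul (isHomogeneous_X K _)).sub
      ((isHomogeneous_X K _).mul (isHomogeneous_X K _))⟩
  have h2 : (binomialEdgeIdeal K G ^ t).IsHomogeneous (homogeneousSubmodule (V ⊕ V) K) := by
    induction t with
    | zero => rw [pow_zero, Ideal.one_eq_top]; exact Ideal.IsHomogeneous.top _
    | succ t ih => rw [pow_succ]; exact ih.mul h1
  exact fun p hp e => homogeneousComponent_mem_of_mem h2 hp e

lemma qv_mem (n i : ℕ) (hi : i < n) : qv K n i ∈ Qid K n :=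
  Ideal.subset_span ⟨⟨i, hi⟩, rfl⟩

theorem induced_path_bound [Finite V] (G : SimpleGraph V) (u : ℕ → V) (n : ℕ) (hn : 0 < n)
    (hu : ∀ i ≤ n, ∀ j ≤ n, u i = u j → i = j)
    (hadj : ∀ i ≤ n, ∀ j ≤ n, G.Adj (u i) (u j) ↔ (j = i + 1 ∨ i = j + 1)) (t : ℕ)
    (F : GradedFreeResolution (K := K) (binomialEdgeIdeal K G ^ (t+1))) (m : ℕ)
    (hF : ∀ r, F.tw n r ≤ m + n) :
    2 * t + n ≤ m := by
  classical
  have := Fintype.ofFinite (V ⊕ V)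
  let _ : LinearOrder (V ⊕ V) :=
    LinearOrder.lift' (Fintype.equivFin (V ⊕ V)) (Equiv.injective _)
  let x : ℕ → V ⊕ V := fun i => Sum.inl (u i)
  let y : ℕ → V ⊕ V := fun i => Sum.inr (u i)
  have hx : ∀ i ≤ n, ∀ j ≤ n, x i = x j → i = j := fun i hi j hj h =>
    hu i hi j hj (Sum.inl_injective h)
  have hy : ∀ i ≤ n, ∀ j ≤ n, y i = y j → i = j := fun i hi j hj h =>
    hu i hi j hj (Sum.inr_injective h)
  have hxy : ∀ i j, x i ≠ y j := fun i j h => by simp [x, y] at h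
  have hinl : ∀ v, kph K x y n (X (Sum.inl v)) =
      ∑ l ∈ Finset.range n, if v = u l then zv K n l else 0 := by
    intro v
    rw [kph_X]
    simp [x, y]
  have hinr : ∀ v, kph K x y n (X (Sum.inr v)) =
      ∑ l ∈ Finset.range n, if v = u (l+1) then zv K n l else 0 := by
    intro v
    rw [kph_X]
    simp [x, y]
  have hphx : ∀ i ≤ n, kph K x y n (X (Sum.inl (u i))) = zv K n i := by
    intro i hi
    rw [hinl]
    by_cases hin : i < n
    · rw [Finset.sum_eq_single i]
      · simp
      · intro l hl hli
        rw [if_neg]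
        exact fun h => hli (hu _ hi _ (Finset.mem_range.1 hl).le h).symm
      · intro h; exact absurd (Finset.mem_range.2 hin) h
    · rw [zv, dif_neg hin]
      refine Finset.sum_eq_zero fun l hl => if_neg fun h => ?_
      have := hu _ hi _ (Finset.mem_range.1 hl).le h
      have := Finset.mem_range.1 hl
      omega
  have hphy : ∀ i ≤ n, kph K x y n (X (Sum.inr (u i))) = if i = 0 then 0 else zv K n (i-1) := by
    intro i hi
    rw [hinr]
    split_ifs with h0
    · refine Finset.sum_eq_zero fun l hl => if_neg fun h => ?_
      have h1 := Finset.mem_range.1 hl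
      have := hu _ hi _ (by omega) h
      omega
    · rw [Finset.sum_eq_single (i-1)]
      · rw [if_pos]; congr; omega
      · intro l hl hli
        rw [if_neg]
        intro h
        have h1 := Finset.mem_range.1 hl
        have := hu _ hi _ (by omega) h
        omega
      · intro h; exact absurd (Finset.mem_range.2 (by omega)) h
  have hoff : ∀ v, (∀ i ≤ n, v ≠ u i) →
      kph K x y n (X (Sum.inl v)) = 0 ∧ kph K x y n (X (Sum.inr v)) = 0 := by
    intro v hv
    rw [hinl, hinr]
    constructor
    · exact Finset.sum_eq_zero fun l hl => if_neg (hv _ (Finset.mem_range.1 hl).le)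
    · exact Finset.sum_eq_zero fun l hl => if_neg (hv _ (Finset.mem_range.1 hl))
  have hstep : ∀ i < n, kph K x y n (X (Sum.inl (u i)) * X (Sum.inr (u (i+1))) -
      X (Sum.inl (u (i+1))) * X (Sum.inr (u i))) = qv K n i := by
    intro i hi
    rw [map_sub, map_mul, map_mul, hphx _ hi.le, hphx (i+1) hi, hphy _ hi.le, hphy (i+1) hi, qv]
    simp only [Nat.succ_ne_zero, if_false, Nat.add_sub_cancel]
    ring
  refine path_bound x y n hn hx hy hxy (binomialEdgeIdeal K G) t (bei_pow_homog G _) ?_ ?_ F m hF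
  · intro i hi
    exact Ideal.subset_span ⟨u i, u (i+1), (hadj _ hi.le _ hi).2 (Or.inl rfl), rfl⟩
  · rw [binomialEdgeIdeal, Ideal.map_span, Ideal.span_le]
    rintro _ ⟨_, ⟨v, w, hvw, rfl⟩, rfl⟩
    by_cases hv : ∀ i ≤ n, v ≠ u i
    · have := hoff v hv
      simp [this.1, this.2]
    by_cases hw : ∀ i ≤ n, w ≠ u i
    · have := hoff w hw
      simp [this.1, this.2]
    push Not at hv hw
    obtain ⟨i, hi, rfl⟩ := hv
    obtain ⟨j, hj, rfl⟩ := hw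
    rcases (hadj i hi j hj).1 hvw with rfl | rfl
    · have h1 := hstep i hj
      have h2 := qv_mem (K := K) n i hj
      rw [← h1] at h2
      exact h2
    · have h1 := hstep j hi
      have h2 := (Qid K n).neg_mem (qv_mem (K := K) n j hi)
      rw [← h1, ← map_neg, neg_sub] at h2
      exact h2

theorem induced_path_reg [Finite V] (G : SimpleGraph V) (u : ℕ → V) (n : ℕ) (hn : 0 < n)
    (hu : ∀ i ≤ n, ∀ j ≤ n, u i = u j → i = j)
    (hadj : ∀ i ≤ n, ∀ j ≤ n, G.Adj (u i) (u j) ↔ (j = i + 1 ∨ i = j + 1)) (t : ℕ) :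
    2 * t + n ≤ quotRegularity K (binomialEdgeIdeal K G ^ (t+1)) := by
  apply le_csInf
  · obtain ⟨F⟩ := exists_resolution (binomialEdgeIdeal K G ^ (t+1)) (bei_pow_homog G _)
    refine ⟨∑ i ∈ Finset.range (F.len + 1), ∑ r, F.tw i r, F, fun i r => ?_⟩
    have hi : i < F.len + 1 := by
      by_contra h
      have := F.finite i (by omega)
      have := r.2
      omega
    have h1 : F.tw i r ≤ ∑ r, F.tw i r :=
      Finset.single_le_sum (f := fun r => F.tw i r) (fun _ _ => Nat.zero_le _) (Finset.mem_univ r)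
    have h2 := Finset.single_le_sum (f := fun i => ∑ r, F.tw i r) (fun _ _ => Nat.zero_le _)
      (Finset.mem_range.2 hi)
    have h3 : ∑ r, F.tw i r ≤ ∑ i ∈ Finset.range (F.len + 1), ∑ r, F.tw i r := h2
    omega
  · rintro m ⟨F, hF⟩
    exact induced_path_bound G u n hn hu hadj t F m (hF n)

end Graph

theorem reg_power_lower_bound_double_points {P : Type*} {k d : ℕ}
    (hk : 4 ≤ k) (hd : 1 ≤ d) (C : Fin k → Set P) (S : Finset P)
    (hS : ∀ p : P, p ∈ S ↔ ∃ i j : Fin k, i ≠ j ∧ p ∈ C i ∧ p ∈ C j)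
    (hpair : ∀ i j : Fin k, i ≠ j → (C i ∩ C j).ncard = d ^ 2)
    (ht2 : S.Nonempty)
    (hdouble : ∀ p ∈ S, {i : Fin k | p ∈ C i}.ncard = 2)
    (K : Type*) [Field K] :
    ∀ t : ℕ, 1 ≤ t →
      2 * t + 2 * k - 4 ≤ quotRegularity K ((binomialEdgeIdeal K (leviGraph C S)) ^ t) := by
  intro t ht
  obtain ⟨t, rfl⟩ : ∃ s, t = s + 1 := ⟨t - 1, by omega⟩
  have hk0 : 0 < k := by omega
  -- curves indexed by ℕ
  let c : ℕ → Fin k := fun i => ⟨i % k, Nat.mod_lt _ hk0⟩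
  have hc : ∀ i < k, ∀ j < k, c i = c j → i = j := by
    intro i hi j hj h
    have := congrArg Fin.val h
    simpa [c, Nat.mod_eq_of_lt hi, Nat.mod_eq_of_lt hj] using this
  have hp : ∀ i : ℕ, ∃ p : {p // p ∈ S}, i + 1 < k →
      ∀ j : Fin k, (p : P) ∈ C j ↔ (j = c i ∨ j = c (i+1)) := by
    intro i
    by_cases hi : i + 1 < k
    · have hne : c i ≠ c (i+1) := fun h => by
        have := hc _ (by omega) _ hi h; omega
      have h1 : (C (c i) ∩ C (c (i+1))).Nonempty := by
        apply Set.nonempty_of_ncard_ne_zero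
        rw [hpair _ _ hne]
        positivity
      obtain ⟨p, hp1, hp2⟩ := h1
      have hpS : p ∈ S := (hS p).2 ⟨_, _, hne, hp1, hp2⟩
      refine ⟨⟨p, hpS⟩, fun _ => ?_⟩
      have h2 : ({c i, c (i+1)} : Set (Fin k)) = {i : Fin k | p ∈ C i} := by
        apply Set.eq_of_subset_of_ncard_le
        · rintro j (rfl | rfl)
          · exact hp1
          · exact hp2
        · rw [hdouble p hpS, Set.ncard_pair hne]
        · exact Set.toFinite _
      intro j
      have h3 := Set.ext_iff.1 h2 j
      simpa using h3.symm
    · obtain ⟨p, hp⟩ := ht2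
      exact ⟨⟨p, hp⟩, fun h => absurd h hi⟩
  choose p hp using hp
  let u : ℕ → {p // p ∈ S} ⊕ Fin k := fun a =>
    if a % 2 = 0 then Sum.inr (c (a / 2)) else Sum.inl (p (a / 2))
  have hev : ∀ a, u (2 * a) = Sum.inr (c a) := by
    intro a
    simp [u]
  have hod : ∀ a, u (2 * a + 1) = Sum.inl (p a) := by
    intro a
    have h1 : (2 * a + 1) % 2 ≠ 0 := by omega
    have h2 : (2 * a + 1) / 2 = a := by omega
    simp only [u, if_neg h1, h2]
  have hinc : ∀ a b, a + 1 < k → b < k → ((p a : P) ∈ C (c b) ↔ (b = a ∨ b = a + 1)) := by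
    intro a b ha hb
    rw [hp a ha]
    constructor
    · rintro (h | h)
      · exact Or.inl (hc _ hb _ (by omega) h)
      · exact Or.inr (hc _ hb _ (by omega) h)
    · rintro (rfl | rfl)
      · exact Or.inl rfl
      · exact Or.inr rfl
  have hadjLR : ∀ (q : {p // p ∈ S}) (i : Fin k),
      (leviGraph C S).Adj (Sum.inl q) (Sum.inr i) ↔ (q : P) ∈ C i := by
    intro q i
    simp [leviGraph, SimpleGraph.fromRel_adj]
  have hadjLL : ∀ (q q' : {p // p ∈ S}), ¬ (leviGraph C S).Adj (Sum.inl q) (Sum.inl q') := by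
    intro q i
    simp [leviGraph, SimpleGraph.fromRel_adj]
  have hadjRR : ∀ (i j : Fin k), ¬ (leviGraph C S).Adj (Sum.inr i) (Sum.inr j) := by
    intro q i
    simp [leviGraph, SimpleGraph.fromRel_adj]
  have main := induced_path_reg (K := K) (leviGraph C S) u (2 * k - 2) (by omega) ?_ ?_ t
  · have : 2 * (t + 1) + 2 * k - 4 = 2 * t + (2 * k - 2) := by omega
    rw [this]
    exact main
  · intro i hi j hj hij
    obtain ⟨a, rfl | rfl⟩ := Nat.even_or_odd' i <;> obtain ⟨b, rfl | rfl⟩ := Nat.even_or_odd' j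
    · rw [hev, hev] at hij
      have := hc _ (by omega) _ (by omega) (Sum.inr_injective hij)
      omega
    · rw [hev, hod] at hij; cases hij
    · rw [hev, hod] at hij; cases hij
    · rw [hod, hod] at hij
      have h1 : p a = p b := Sum.inl_injective hij
      have e1 := (hinc a a (by omega) (by omega)).2 (Or.inl rfl)
      have e2 := (hinc a (a+1) (by omega) (by omega)).2 (Or.inr rfl)
      rw [h1] at e1 e2
      have e3 := (hinc b a (by omega) (by omega)).1 e1
      have e4 := (hinc b (a+1) (by omega) (by omega)).1 e2
      omega
  · intro i hi j hj
    obtain ⟨a, rfl | rfl⟩ := Nat.even_or_odd' i <;> obtain ⟨b, rfl | rfl⟩ := Nat.even_or_odd' j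
    · rw [hev, hev]
      constructor
      · intro h; exact absurd h (hadjRR _ _)
      · intro h; omega
    · rw [hev, hod, SimpleGraph.adj_comm, hadjLR, hinc b a (by omega) (by omega)]
      omega
    · rw [hev, hod, hadjLR, hinc a b (by omega) (by omega)]
      omega
    · rw [hod, hod]
      constructor
      · intro h; exact absurd h (hadjLL _ _)
      · intro h; omega
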